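/- arXiv:1405.4661 — 4 statements merged into one kernel-verified Lean document; each statement's English description precedes it below -/
import Mathlib

section
/- Let n > 2 be an integer, p_S ≤ p < p_c (where p_c = ∞ if n ≤ 10) and α > 0. Suppose v₀ : ℝⁿ → ℝ is bounded and continuous with v₀(x) ≥ φ_α(|x|) for all x ∈ ℝⁿ and v₀ ≢ φ_α(|·|). Then every bounded classical solution v of (v^p)_t = Δv + v^p on ℝⁿ with initial data v₀ satisfies ‖v(·,t)‖_{L^∞(ℝⁿ)} → ∞ as t → ∞. -/
noncomputable section

open Real Filter Set

/-- The Sobolev exponent `p_S = (n+2)/(n-2)`. -/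
def pS (n : ℕ) : ℝ := ((n : ℝ) + 2) / ((n : ℝ) - 2)

/-- The critical exponent `p_c` for `n > 10`. -/
def pc (n : ℕ) : ℝ :=
  (((n : ℝ) - 2) ^ 2 - 4 * (n : ℝ) + 8 * Real.sqrt ((n : ℝ) - 1)) /
    (((n : ℝ) - 2) * ((n : ℝ) - 10))

/-- `φ` is the (radial profile of the) positive steady state `φ_α` of `Δφ + φ^p = 0`,
i.e. the solution of `φ'' + ((n−1)/r)φ' + φ^p = 0` on `(0,∞)` with `φ(0) = α`, `φ'(0) = 0`,
which is positive, strictly decreasing on `[0,∞)` and tends to `0` at infinity. -/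
structure IsSteadyState (n : ℕ) (p α : ℝ) (φ : ℝ → ℝ) : Prop where
  cont : ContinuousOn φ (Set.Ici 0)
  smooth : ContDiffOn ℝ 2 φ (Set.Ioi 0)
  ode : ∀ r > (0 : ℝ), deriv (deriv φ) r + ((n : ℝ) - 1) / r * deriv φ r + φ r ^ p = 0
  val0 : φ 0 = α
  deriv0 : derivWithin φ (Set.Ici 0) 0 = 0
  pos : ∀ r ≥ (0 : ℝ), 0 < φ r
  anti : StrictAntiOn φ (Set.Ici 0)
  lim : Tendsto φ atTop (nhds 0)

/-- The Laplacian of `f : ℝⁿ → ℝ` at `x`, as the sum of second partial derivatives. -/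
def lap (n : ℕ) (f : EuclideanSpace ℝ (Fin n) → ℝ) (x : EuclideanSpace ℝ (Fin n)) : ℝ :=
  ∑ i : Fin n, fderiv ℝ (fun y => fderiv ℝ f y (EuclideanSpace.single i 1)) x
    (EuclideanSpace.single i 1)

/-- `v` is a bounded classical solution of `(v^p)_t = Δv + v^p` on `ℝⁿ × (0,∞)` with
initial data `v₀`. -/
structure IsBddClassicalSol (n : ℕ) (p : ℝ) (v : EuclideanSpace ℝ (Fin n) → ℝ → ℝ)
    (v₀ : EuclideanSpace ℝ (Fin n) → ℝ) : Prop where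
  nonneg : ∀ x, ∀ t ≥ (0 : ℝ), 0 ≤ v x t
  cont : ContinuousOn (fun q : EuclideanSpace ℝ (Fin n) × ℝ => v q.1 q.2)
    ((Set.univ : Set (EuclideanSpace ℝ (Fin n))) ×ˢ Set.Ici (0 : ℝ))
  bdd : ∀ T > (0 : ℝ), ∃ M, ∀ x, ∀ t ∈ Set.Icc (0 : ℝ) T, v x t ≤ M
  smooth_space : ∀ t > (0 : ℝ), ContDiff ℝ 2 fun x => v x t
  smooth_time : ∀ x, ContDiffOn ℝ 1 (fun s => v x s ^ p) (Set.Ioi (0 : ℝ))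
  pde : ∀ x, ∀ t > (0 : ℝ),
    deriv (fun s => v x s ^ p) t = lap n (fun y => v y t) x + v x t ^ p
  init : ∀ x, v x 0 = v₀ x


namespace Inst

section A
variable {n : ℕ} {p α : ℝ} {φ : ℝ → ℝ}

lemma hd1 (hφ : IsSteadyState n p α φ) {r : ℝ} (hr : 0 < r) : HasDerivAt φ (deriv φ r) r := by
  have h := (hφ.smooth.contDiffAt (Ioi_mem_nhds hr)).differentiableAt (by norm_num)
  exact h.hasDerivAt

lemma hd2 (hφ : IsSteadyState n p α φ) {r : ℝ} (hr : 0 < r) :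
    HasDerivAt (deriv φ) (-((n : ℝ) - 1) / r * deriv φ r - φ r ^ p) r := by
  have h : ContDiffOn ℝ 1 (deriv φ) (Ioi 0) := by
    have := hφ.smooth
    rw [show (2 : WithTop ℕ∞) = 1 + 1 by norm_num, contDiffOn_succ_iff_deriv_of_isOpen isOpen_Ioi] at this
    exact this.2.2
  have h2 := (h.contDiffAt (Ioi_mem_nhds hr)).differentiableAt (by norm_num)
  have h3 := h2.hasDerivAt
  have := hφ.ode r hr
  refine h3.congr_deriv ?_
  have e : -((n : ℝ) - 1) / r * deriv φ r = - (((n : ℝ) - 1) / r * deriv φ r) := by ring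
  rw [e]; linarith

lemma d1_nonpos (hφ : IsSteadyState n p α φ) {r : ℝ} (hr : 0 < r) : deriv φ r ≤ 0 := by
  have h := hd1 hφ hr
  refine le_of_tendsto (h.tendsto_slope.mono_left (nhdsWithin_mono r (s := Ioi r) (fun x hx => ne_of_gt hx))) ?_
  filter_upwards [self_mem_nhdsWithin] with x hx
  have hx' : r < x := hx
  rw [slope_def_field]
  have := hφ.anti (show r ∈ Ici 0 from hr.le) (show x ∈ Ici 0 from (hr.trans hx').le) hx'
  apply div_nonpos_of_nonpos_of_nonneg <;> linarith

lemma hdN (hφ : IsSteadyState n p α φ) (hn : 2 < n) {r : ℝ} (hr : 0 < r) :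
    HasDerivAt (fun r => - (r ^ (n - 1) * deriv φ r)) (r ^ (n - 1) * φ r ^ p) r := by
  have h := ((hasDerivAt_pow (n - 1) r).mul (hd2 hφ hr)).neg
  refine HasDerivAt.congr_deriv h ?_
  obtain ⟨m, rfl⟩ : ∃ m, n = m + 2 := ⟨n - 2, by omega⟩
  have : m + 2 - 1 = m + 1 := by omega
  rw [this]
  push_cast
  field_simp
  simp
  ring

lemma phi_le (hφ : IsSteadyState n p α φ) {r : ℝ} (hr : 0 ≤ r) : φ r ≤ α := by
  rw [← hφ.val0]
  exact hφ.anti.antitoneOn (Set.mem_Ici.2 (le_refl (0:ℝ))) hr hr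

lemma mono_Ioc {f f' : ℝ → ℝ} {S : Set ℝ} (hS : Convex ℝ S) (hd : ∀ x ∈ S, HasDerivAt f (f' x) x)
    (h0 : ∀ x ∈ S, 0 ≤ f' x) : MonotoneOn f S := by
  apply monotoneOn_of_deriv_nonneg hS
  · exact fun x hx => (hd x hx).continuousAt.continuousWithinAt
  · exact fun x hx => (hd x (interior_subset hx)).differentiableAt.differentiableWithinAt
  · intro x hx
    rw [(hd x (interior_subset hx)).deriv]
    exact h0 x (interior_subset hx)

lemma d1_upper (hφ : IsSteadyState n p α φ) (hn : 2 < n) (hp : 1 < p) {r : ℝ} (hr : 0 < r) :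
    r * φ r ^ p ≤ n * (- deriv φ r) := by
  have hn0 : (0:ℝ) < n := by positivity
  have hm : MonotoneOn (fun s => - (s ^ (n - 1) * deriv φ s) - φ r ^ p * s ^ n / n) (Ioc 0 r) := by
    refine mono_Ioc (f' := fun s => s ^ (n-1) * φ s ^ p - φ r ^ p * (n * s ^ (n-1)) / n) (convex_Ioc 0 r) ?_ ?_
    · intro x hx
      exact (hdN hφ hn hx.1).sub (((hasDerivAt_pow n x).const_mul _).div_const _)
    · intro x hx
      have h1 : φ r ≤ φ x := hφ.anti.antitoneOn hx.1.le hr.le hx.2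
      have h2 : φ r ^ p ≤ φ x ^ p := Real.rpow_le_rpow (hφ.pos r hr.le).le h1 (by linarith)
      have h3 : 0 < x ^ (n-1) := pow_pos hx.1 _
      have : φ r ^ p * (n * x ^ (n-1)) / n = φ r ^ p * x ^ (n-1) := by field_simp
      rw [this]
      nlinarith
  have key : ∀ s ∈ Ioo 0 r, φ r ^ p * (r ^ n - s ^ n) / n ≤ - (r ^ (n - 1) * deriv φ r) := by
    intro s hs
    have h1 := hm ⟨hs.1, hs.2.le⟩ ⟨hr, le_refl r⟩ hs.2.le
    simp only at h1
    have h2 := d1_nonpos hφ hs.1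
    have h3 : 0 < s ^ (n-1) := pow_pos hs.1 _
    have h4 : s ^ (n-1) * deriv φ s ≤ 0 := mul_nonpos_of_nonneg_of_nonpos h3.le h2
    have h5 : φ r ^ p * (r ^ n - s ^ n) / n = φ r ^ p * r ^ n / n - φ r ^ p * s ^ n / n := by ring
    rw [h5]; linarith
  have lim : Tendsto (fun s : ℝ => φ r ^ p * (r ^ n - s ^ n) / n) (nhdsWithin 0 (Ioi 0)) (nhds (φ r ^ p * (r ^ n - 0 ^ n) / n)) := by
    apply Tendsto.mono_left _ nhdsWithin_le_nhds
    apply Continuous.tendsto (f := fun s : ℝ => φ r ^ p * (r ^ n - s ^ n) / n)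
    fun_prop
  have h := le_of_tendsto lim (by
    filter_upwards [Ioo_mem_nhdsGT hr] with s hs using key s hs)
  rw [zero_pow (by omega), sub_zero] at h
  obtain ⟨m, rfl⟩ : ∃ m, n = m + 1 := ⟨n - 1, by omega⟩
  simp only [Nat.add_sub_cancel] at h
  rw [div_le_iff₀ hn0] at h
  have h3 : 0 < r ^ m := pow_pos hr _
  rw [pow_succ] at h
  have : r ^ m * (r * φ r ^ p) ≤ r ^ m * (((m+1 : ℕ):ℝ) * -deriv φ r) := by nlinarith
  exact le_of_mul_le_mul_left this h3

lemma d1_neg (hφ : IsSteadyState n p α φ) (hn : 2 < n) (hp : 1 < p) {r : ℝ} (hr : 0 < r) :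
    deriv φ r < 0 := by
  have h := d1_upper hφ hn hp hr
  have h1 : 0 < r * φ r ^ p := mul_pos hr (Real.rpow_pos_of_pos (hφ.pos r hr.le) _)
  have hn0 : (0:ℝ) < n := by positivity
  by_contra hc
  push Not at hc
  nlinarith

lemma N_small (hφ : IsSteadyState n p α φ) (hn : 2 < n) {r ε : ℝ} (hr : 0 < r) (hε : 0 < ε) :
    ∃ s ∈ Ioo 0 r, - (s ^ (n - 1) * deriv φ s) < ε := by
  by_contra hc
  push Not at hc
  set R := min r 1 with hR
  have hR0 : 0 < R := lt_min hr one_pos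
  -- φ + ε log antitone
  have hm : MonotoneOn (fun s => - φ s - ε * Real.log s) (Ioo 0 R) := by
    refine mono_Ioc (f' := fun s => - deriv φ s - ε * s⁻¹) (convex_Ioo 0 R) ?_ ?_
    · intro x hx
      exact (hd1 hφ hx.1).neg.sub ((Real.hasDerivAt_log hx.1.ne').const_mul _)
    · intro x hx
      have hx1 : x ≤ 1 := hx.2.le.trans (min_le_right _ _)
      have h := hc x ⟨hx.1, hx.2.trans_le (min_le_left _ _)⟩
      have h2 := d1_nonpos hφ hx.1
      have h3 : x ^ (n-1) ≤ x := by
        calc x ^ (n-1) ≤ x ^ 1 := pow_le_pow_of_le_one hx.1.le hx1 (by omega)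
          _ = x := pow_one x
      have h4 : ε ≤ x * (- deriv φ x) := by nlinarith
      have h5 : ε * x⁻¹ ≤ - deriv φ x := by
        rw [← div_eq_mul_inv, div_le_iff₀ hx.1]; linarith
      linarith
  have hb : ∀ s ∈ Ioo 0 (R/2), -ε * Real.log s ≤ α - φ (R/2) - ε * Real.log (R/2) := by
    intro s hs
    have h := hm ⟨hs.1, by linarith [hs.2]⟩ ⟨by linarith, by linarith⟩ hs.2.le
    simp only at h
    have := phi_le hφ hs.1.le
    linarith
  have hlim : Tendsto (fun s => -ε * Real.log s) (nhdsWithin 0 (Ioi 0)) atTop :=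
    Real.tendsto_log_nhdsGT_zero.const_mul_atBot_of_neg (by linarith)
  have h1 := hlim.eventually_gt_atTop (α - φ (R/2) - ε * Real.log (R/2))
  have h2 : ∀ᶠ s in nhdsWithin (0:ℝ) (Ioi 0), s ∈ Ioo 0 (R/2) := Ioo_mem_nhdsGT (by linarith)
  obtain ⟨s, hs1, hs2⟩ := (h1.and h2).exists
  linarith [hb s hs2]

lemma d1_lower (hφ : IsSteadyState n p α φ) (hn : 2 < n) (hp : 1 < p) {r : ℝ} (hr : 0 < r) :
    n * (- deriv φ r) ≤ α ^ p * r := by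
  have hn0 : (0:ℝ) < n := by positivity
  have hα : 0 < α := hφ.val0 ▸ hφ.pos 0 le_rfl
  have hm : MonotoneOn (fun s => α ^ p * s ^ n / n - (- (s ^ (n - 1) * deriv φ s))) (Ioi 0) := by
    refine mono_Ioc (f' := fun s => α ^ p * (n * s ^ (n-1)) / n - s ^ (n-1) * φ s ^ p) (convex_Ioi 0) ?_ ?_
    · intro x hx
      exact ((((hasDerivAt_pow n x).const_mul _).div_const _)).sub (hdN hφ hn hx)
    · intro x hx
      have h2 : φ x ^ p ≤ α ^ p := Real.rpow_le_rpow (hφ.pos x (le_of_lt hx)).le (phi_le hφ (le_of_lt hx)) (by linarith)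
      have h3 : 0 < x ^ (n-1) := pow_pos hx _
      have : α ^ p * (n * x ^ (n-1)) / n = α ^ p * x ^ (n-1) := by field_simp
      rw [this]
      nlinarith
  have key : - (r ^ (n - 1) * deriv φ r) ≤ α ^ p * r ^ n / n := by
    apply le_of_forall_pos_le_add
    intro ε hε
    obtain ⟨s, hs, hs2⟩ := N_small hφ hn hr hε
    have h1 := hm hs.1 hr hs.2.le
    simp only at h1
    have : 0 ≤ α ^ p * s ^ n / n := by have := hs.1; positivity
    linarith
  rw [le_div_iff₀ hn0] at key
  obtain ⟨m, rfl⟩ : ∃ m, n = m + 1 := ⟨n - 1, by omega⟩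
  simp only [Nat.add_sub_cancel] at key
  have h3 : 0 < r ^ m := pow_pos hr _
  rw [pow_succ] at key
  have : r ^ m * (((m+1 : ℕ):ℝ) * -deriv φ r) ≤ r ^ m * (α ^ p * r) := by nlinarith
  exact le_of_mul_le_mul_left this h3

lemma phi_lower (hφ : IsSteadyState n p α φ) (hn : 2 < n) (hp : 1 < p) {r : ℝ} (hr : 0 ≤ r) :
    α - α ^ p / (2 * n) * r ^ 2 ≤ φ r := by
  have hn0 : (0:ℝ) < n := by positivity
  have hm : MonotoneOn (fun s => φ s + α ^ p / (2 * n) * s ^ 2) (Ici 0) := by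
    apply monotoneOn_of_deriv_nonneg (convex_Ici 0)
    · exact hφ.cont.add (by fun_prop)
    · intro x hx
      rw [interior_Ici] at hx
      have := hd1 hφ hx
      exact (this.differentiableAt.add (by fun_prop)).differentiableWithinAt
    · intro x hx
      rw [interior_Ici] at hx
      have h := (hd1 hφ hx).add ((hasDerivAt_pow 2 x).const_mul (α ^ p / (2 * n)))
      have := d1_lower hφ hn hp hx
      have e := h.deriv
      rw [show (fun s => φ s + α ^ p / (2 * n) * s ^ 2) = φ + fun s => α ^ p / (2 * n) * s ^ 2 from rfl, e]
      have : - deriv φ x ≤ α ^ p * x / n := by rw [le_div_iff₀ hn0]; linarith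
      have e2 : α ^ p / (2 * ↑n) * (↑2 * x ^ (2 - 1)) = α ^ p * x / n := by
        norm_num; field_simp
      norm_num at e2 ⊢
      linarith
  have h := hm (Set.mem_Ici.2 (le_refl (0:ℝ))) hr hr
  simp only [hφ.val0] at h
  norm_num at h
  linarith
end A
end Inst

namespace Inst

/-- second derivative test (necessary condition) -/
lemma second_deriv_nonneg {f f' : ℝ → ℝ} {d x : ℝ} (h1 : ∀ᶠ s in nhds x, HasDerivAt f (f' s) s)
    (h2 : HasDerivAt f' d x) (hmin : IsLocalMin f x) : 0 ≤ d := by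
  by_contra hc
  push Not at hc
  have h0 : f' x = 0 := hmin.hasDerivAt_eq_zero h1.self_of_nhds
  -- f' < 0 on the right of x
  have h3 : ∀ᶠ s in nhdsWithin x (Ioi x), f' s < 0 := by
    have := h2.tendsto_slope.mono_left (nhdsWithin_mono x (s := Ioi x) (fun y hy => ne_of_gt hy))
    filter_upwards [this.eventually_lt_const hc, self_mem_nhdsWithin] with s hs hs2
    have hs2' : x < s := hs2
    rw [slope_def_field, h0, sub_zero] at hs
    by_contra hcc
    push Not at hcc
    have : 0 ≤ f' s / (s - x) := div_nonneg hcc (by linarith)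
    linarith
  have h4 : ∀ᶠ s in nhdsWithin x (Ioi x), f x ≤ f s := nhdsWithin_le_nhds hmin
  have h5 := nhdsWithin_le_nhds (s := Ioi x) h1
  obtain ⟨u, hu, hu2⟩ := (mem_nhdsGT_iff_exists_Ioo_subset).1 (h3.and (h4.and h5))
  have hxu : x < u := hu
  set y := (x + u) / 2
  have hy : y ∈ Ioo x u := ⟨by simp only [y]; linarith, by simp only [y]; linarith⟩
  obtain ⟨c, hc1, hc2⟩ := exists_hasDerivAt_eq_slope f f' hy.1 (by
    intro s hs
    rcases eq_or_lt_of_le hs.1 with h | h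
    · rw [← h]; exact h1.self_of_nhds.continuousAt.continuousWithinAt
    · exact (hu2 ⟨h, hs.2.trans_lt hy.2⟩).2.2.continuousAt.continuousWithinAt) (by
    intro s hs
    exact (hu2 ⟨hs.1, hs.2.trans hy.2⟩).2.2)
  have h6 := (hu2 ⟨hc1.1, hc1.2.trans hy.2⟩).1
  have h7 := (hu2 hy).2.1
  rw [hc2] at h6
  have : 0 ≤ (f y - f x) / (y - x) := div_nonneg (by linarith) (by linarith [hy.1])
  linarith

structure EF (a b p : ℝ) (w w1 : ℝ → ℝ) : Prop where
  ha : 0 ≤ a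
  hb : 0 < b
  hp : 1 < p
  hw : ∀ y, HasDerivAt w (w1 y) y
  hw1 : ∀ y, HasDerivAt w1 (-a * w1 y + (b * w y - w y ^ p)) y
  pos : ∀ y, 0 < w y
  lim : Tendsto w atBot (nhds 0)

section B
variable {a b p : ℝ} {w w1 : ℝ → ℝ}

def FF (b p x : ℝ) : ℝ := x ^ (p + 1) / (p + 1) - b * x ^ 2 / 2

def EE (b p : ℝ) (w w1 : ℝ → ℝ) (y : ℝ) : ℝ := w1 y ^ 2 / 2 + FF b p (w y)

lemma hdF (hp : 1 < p) (x : ℝ) : HasDerivAt (FF b p) (x ^ p - b * x) x := by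
  have h1 := (Real.hasDerivAt_rpow_const (x := x) (p := p + 1) (Or.inr (by linarith))).div_const (p+1)
  have h2 := ((hasDerivAt_pow 2 x).const_mul b).div_const 2
  refine (h1.sub h2).congr_deriv ?_
  have : p + 1 ≠ 0 := by linarith
  rw [add_sub_cancel_right]
  field_simp
  norm_num
  ring

lemma hdE (h : EF a b p w w1) (y : ℝ) : HasDerivAt (EE b p w w1) (-a * w1 y ^ 2) y := by
  have h1 := ((h.hw1 y).pow 2).div_const 2
  have h2 := (hdF (b := b) h.hp (w y)).comp y (h.hw y)
  refine (h1.add h2).congr_deriv ?_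
  norm_num
  ring

lemma E_anti (h : EF a b p w w1) : Antitone (EE b p w w1) := by
  apply antitone_of_deriv_nonpos
  · exact fun y => (hdE h y).differentiableAt
  · intro y
    rw [(hdE h y).deriv]
    have := h.ha
    nlinarith [mul_nonneg h.ha (sq_nonneg (w1 y))]

lemma small_pt (h : EF a b p w w1) (y : ℝ) {ε : ℝ} (hε : 0 < ε) :
    ∃ ξ ≤ y, |w1 ξ| ≤ ε ∧ w ξ ≤ ε := by
  obtain ⟨N, hN⟩ := eventually_atBot.1 (h.lim.eventually_le_const hε)
  set z := min N y
  obtain ⟨c, hc, hc2⟩ := exists_hasDerivAt_eq_slope w w1 (show z - 1 < z by linarith)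
    (fun s _ => (h.hw s).continuousAt.continuousWithinAt) (fun s _ => h.hw s)
  have hz1 : z ≤ N := min_le_left _ _
  have hz2 : z ≤ y := min_le_right _ _
  refine ⟨c, by linarith [hc.2], ?_, hN c (by linarith [hc.2])⟩
  rw [hc2]
  have e1 := hN z hz1
  have e2 := hN (z-1) (by linarith)
  have e3 := h.pos z
  have e4 := h.pos (z-1)
  rw [show z - (z-1) = 1 by ring, div_one, abs_le]
  constructor <;> linarith

lemma E_nonpos (h : EF a b p w w1) (y : ℝ) : EE b p w w1 y ≤ 0 := by
  apply le_of_forall_pos_le_add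
  intro ε' hε'
  set ε := min ε' 1
  have hε : 0 < ε := lt_min hε' one_pos
  have hε1 : ε ≤ 1 := min_le_right _ _
  have hεε : ε ≤ ε' := min_le_left _ _
  obtain ⟨ξ, h1, h2, h3⟩ := small_pt h y hε
  have h4 := E_anti h h1
  have h5 : EE b p w w1 ξ ≤ ε := by
    unfold EE FF
    have e1 : w1 ξ ^ 2 ≤ ε ^ 2 := sq_le_sq' (abs_le.1 h2).1 (abs_le.1 h2).2
    have e2 : ε ^ 2 ≤ ε := by nlinarith
    have hp := h.hp
    have e3 : w ξ ^ (p + 1) ≤ ε := by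
      calc w ξ ^ (p+1) ≤ ε ^ (p+1) := Real.rpow_le_rpow (h.pos ξ).le h3 (by linarith)
        _ ≤ ε ^ (1:ℝ) := Real.rpow_le_rpow_of_exponent_ge hε hε1 (by linarith)
        _ = ε := Real.rpow_one ε
    have e4 : w ξ ^ (p + 1) / (p+1) ≤ ε / 2 := by
      rw [div_le_div_iff₀ (by linarith) (by norm_num)]
      nlinarith [Real.rpow_nonneg (h.pos ξ).le (p+1)]
    have e5 : 0 ≤ b * w ξ ^ 2 / 2 := by have := h.hb; positivity
    linarith
  linarith

lemma E_zero (h : EF a b p w w1) (ha : a = 0) (y : ℝ) : EE b p w w1 y = 0 := by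
  apply le_antisymm (E_nonpos h y)
  have hconst : ∀ x y, EE b p w w1 x = EE b p w w1 y := by
    apply is_const_of_deriv_eq_zero
    · exact fun y => (hdE h y).differentiableAt
    · intro y; rw [(hdE h y).deriv, ha]; ring
  by_contra hc
  push Not at hc
  have hb := h.hb
  set e := - EE b p w w1 y with he
  have he0 : 0 < e := by linarith
  set ε := min 1 (e / b)
  have hε : 0 < ε := lt_min one_pos (by positivity)
  obtain ⟨ξ, h1, h2, h3⟩ := small_pt h y hε
  have h4 := hconst ξ y
  have h5 : - (b * ε ^ 2 / 2) ≤ EE b p w w1 ξ := by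
    unfold EE FF
    have hp := h.hp
    have e1 : w ξ ^ 2 ≤ ε ^ 2 := by
      have := h.pos ξ
      nlinarith
    have e2 : 0 ≤ w ξ ^ (p + 1) / (p+1) := div_nonneg (Real.rpow_nonneg (h.pos ξ).le _) (by linarith)
    nlinarith [sq_nonneg (w1 ξ)]
  have h6 : ε ^ 2 ≤ e / b := by
    have := min_le_left 1 (e/b)
    have := min_le_right 1 (e/b)
    nlinarith
  have h7 : b * ε ^ 2 ≤ e := by
    rw [le_div_iff₀ hb] at h6; linarith
  linarith

lemma Fx (hp : 1 < p) {x : ℝ} (hx : 0 < x) : FF b p x = x ^ 2 * (x ^ (p - 1) / (p + 1) - b / 2) := by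
  unfold FF
  have : x ^ (p+1) = x ^ 2 * x ^ (p-1) := by
    rw [← Real.rpow_natCast, ← Real.rpow_add hx]; congr 1; push_cast; ring
  rw [this]; ring

lemma pw_split {x : ℝ} (hx : 0 < x) : x ^ p = x * x ^ (p - 1) := by
  have h := Real.rpow_add hx 1 (p - 1)
  rw [Real.rpow_one] at h
  rw [← h]; congr 1; ring

lemma w_lower (h : EF a b p w w1) (ha : 0 < a) : ∃ w0 > 0, ∀ y ≥ 0, w0 ≤ w y := by
  have hb := h.hb
  have h0 : EE b p w w1 0 < 0 := by
    by_contra hc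
    push Not at hc
    have hz : ∀ y ≤ 0, EE b p w w1 y = 0 := fun y hy =>
      le_antisymm (E_nonpos h y) (hc.trans (E_anti h hy))
    have hw0 : ∀ y < 0, w1 y = 0 := by
      intro y hy
      have h1 : HasDerivAt (EE b p w w1) 0 y := by
        apply (hasDerivAt_const y (0:ℝ)).congr_of_eventuallyEq
        filter_upwards [Iio_mem_nhds hy] with x hx using hz x (le_of_lt hx)
      have h2 := (hdE h y).unique h1
      have : w1 y ^ 2 = 0 := by
        rcases mul_eq_zero.1 h2 with h3 | h3
        · linarith
        · exact h3
      exact pow_eq_zero_iff (two_ne_zero) |>.1 this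
    have hcst : ∀ y < -1, w (-1) ≤ w y := by
      intro y hy
      obtain ⟨c, hc, hc2⟩ := exists_hasDerivAt_eq_slope w w1 hy
        (fun s _ => (h.hw s).continuousAt.continuousWithinAt) (fun s _ => h.hw s)
      rw [hw0 c (by linarith [hc.2])] at hc2
      have : w (-1) - w y = 0 := by
        rcases div_eq_zero_iff.1 hc2.symm with h3 | h3
        · exact h3
        · linarith
      linarith
    have := ge_of_tendsto h.lim (eventually_atBot.2 ⟨-2, fun y hy => hcst y (by linarith)⟩)
    linarith [h.pos (-1)]
  set e := - EE b p w w1 0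
  have he : 0 < e := by simp only [e]; linarith
  refine ⟨Real.sqrt (2 * e / b), by positivity, fun y hy => ?_⟩
  rw [Real.sqrt_le_left (h.pos y).le]
  have h1 := E_anti h hy
  rw [div_le_iff₀ hb]
  have hp := h.hp
  unfold EE FF at h1
  have e2 : 0 ≤ w y ^ (p + 1) / (p+1) := div_nonneg (Real.rpow_nonneg (h.pos y).le _) (by linarith)
  simp only [e]
  unfold EE FF
  nlinarith [sq_nonneg (w1 y)]

lemma ratio_anti (h : EF a b p w w1) (ha : a = 0) : Antitone (fun y => w1 y / w y) := by
  have hd : ∀ y, HasDerivAt (fun y => w1 y / w y)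
      (((-a * w1 y + (b * w y - w y ^ p)) * w y - w1 y * w1 y) / w y ^ 2) y := fun y =>
    (h.hw1 y).div (h.hw y) (h.pos y).ne'
  apply antitone_of_deriv_nonpos
  · exact fun y => (hd y).differentiableAt
  · intro y
    rw [(hd y).deriv]
    apply div_nonpos_of_nonpos_of_nonneg _ (by positivity)
    have hE := E_zero h ha y
    have hp := h.hp
    have hw := h.pos y
    unfold EE at hE
    rw [Fx hp hw] at hE
    rw [pw_split hw, ha]
    set q := w y ^ (p-1)
    have hq : 0 < q := Real.rpow_pos_of_pos hw _
    have : q / (p+1) ≤ q / 2 := div_le_div_of_nonneg_left hq.le (by norm_num) (by linarith)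
    have h2 : 0 < w y ^ 2 := by positivity
    nlinarith

end B
end Inst

namespace Inst
section C
variable {a b p : ℝ} {w w1 : ℝ → ℝ}

lemma lim_deriv_le {f f' : ℝ → ℝ} {c B : ℝ} (hd : ∀ y, HasDerivAt f (f' y) y) (hB : ∀ y, |f y| ≤ B)
    (hl : Tendsto f' atTop (nhds c)) : c ≤ 0 := by
  by_contra hc
  push Not at hc
  obtain ⟨Y, hY⟩ := eventually_atTop.1 (hl.eventually_const_le (show c/2 < c by linarith))
  have hm : MonotoneOn (fun y => f y - c / 2 * y) (Ici Y) := by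
    refine mono_Ioc (f' := fun y => f' y - c/2) (convex_Ici Y) ?_ ?_
    · intro y _
      exact ((hd y).sub ((hasDerivAt_id y).const_mul (c/2))).congr_deriv (by ring)
    · intro y hy
      have := hY y hy
      linarith
  have hB0 : 0 ≤ B := (abs_nonneg _).trans (hB 0)
  have hpos : 0 ≤ 4 * (B + 1) / c := by positivity
  have h := hm (Set.mem_Ici.2 le_rfl) (show Y + 4 * (B + 1) / c ∈ Ici Y from by simp [hpos]) (by linarith)
  simp only at h
  have e : c / 2 * (Y + 4 * (B+1) / c) = c / 2 * Y + 2 * (B + 1) := by field_simp; ring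
  rw [e] at h
  have h1 := (abs_le.1 (hB Y)).1
  have h2 := (abs_le.1 (hB (Y + 4 * (B + 1) / c))).2
  linarith

lemma lim_deriv_zero {f f' : ℝ → ℝ} {c B : ℝ} (hd : ∀ y, HasDerivAt f (f' y) y) (hB : ∀ y, |f y| ≤ B)
    (hl : Tendsto f' atTop (nhds c)) : c = 0 := by
  apply le_antisymm (lim_deriv_le hd hB hl)
  have := lim_deriv_le (f := fun y => - f y) (f' := fun y => - f' y) (c := -c) (B := B)
    (fun y => (hd y).neg) (fun y => by rw [abs_neg]; exact hB y) hl.neg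
  linarith

lemma w_bdd (h : EF a b p w w1) (y : ℝ) : w y ^ (p - 1) ≤ b * (p + 1) / 2 ∧ w1 y ^ 2 ≤ b * w y ^ 2 := by
  have hE := E_nonpos h y
  have hp := h.hp
  have hw := h.pos y
  have hq : 0 < w y ^ (p-1) := Real.rpow_pos_of_pos hw _
  unfold EE at hE
  rw [Fx hp hw] at hE
  have h2 : 0 < w y ^ 2 := by positivity
  have hq2 : 0 < w y ^ (p-1) / (p+1) := div_pos hq (by linarith)
  constructor
  · have : w y ^ (p-1) / (p+1) - b / 2 ≤ 0 := by
      by_contra hc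
      push Not at hc
      have := mul_pos h2 hc
      nlinarith [sq_nonneg (w1 y)]
    have : w y ^ (p-1) / (p+1) ≤ b / 2 := by linarith
    rw [div_le_iff₀ (by linarith)] at this
    linarith
  · nlinarith [mul_pos h2 hq2]

lemma exists_decr (h : EF a b p w w1) (hab : a ^ 2 < 4 * ((p - 1) * b)) : ∃ y, w1 y < 0 := by
  by_contra hc
  push Not at hc
  have hp := h.hp
  have hb := h.hb
  have ha := h.ha
  have hmono : Monotone w := by
    apply monotone_of_deriv_nonneg
    · exact fun y => (h.hw y).differentiableAt
    · intro y; rw [(h.hw y).deriv]; exact hc y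
  have hp1 : 0 < p - 1 := by linarith
  obtain ⟨W, hW⟩ : ∃ W, ∀ y, w y ≤ W := by
    refine ⟨(b * (p + 1) / 2) ^ (p-1)⁻¹, fun y => ?_⟩
    rw [Real.le_rpow_inv_iff_of_pos (h.pos y).le (by positivity) hp1]
    exact (w_bdd h y).1
  have hbdd : BddAbove (range w) := ⟨W, by rintro _ ⟨y, rfl⟩; exact hW y⟩
  set ℓ := ⨆ y, w y with hℓ
  have hlim : Tendsto w atTop (nhds ℓ) := tendsto_atTop_ciSup hmono hbdd
  have hle : ∀ y, w y ≤ ℓ := fun y => le_ciSup hbdd y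
  have hℓ0 : 0 < ℓ := (h.pos 0).trans_le (hle 0)
  -- limit equation
  have hGlim : Tendsto (fun y => b * w y - w y ^ p) atTop (nhds (b * ℓ - ℓ ^ p)) :=
    (hlim.const_mul b).sub (hlim.rpow_const (Or.inl hℓ0.ne'))
  have hw1b : ∀ y, |w1 y| ≤ Real.sqrt b * ℓ := by
    intro y
    have h1 := (w_bdd h y).2
    rw [← Real.sqrt_sq_eq_abs, show Real.sqrt b * ℓ = Real.sqrt (b * ℓ^2) by
      rw [Real.sqrt_mul hb.le, Real.sqrt_sq hℓ0.le]]
    apply Real.sqrt_le_sqrt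
    have := hle y
    have := h.pos y
    have : w y ^ 2 ≤ ℓ ^ 2 := by nlinarith
    nlinarith
  have hc0 : b * ℓ - ℓ ^ p = 0 := by
    refine lim_deriv_zero (f := fun y => w1 y + a * w y) (f' := fun y => b * w y - w y ^ p)
      (B := Real.sqrt b * ℓ + a * ℓ) ?_ ?_ hGlim
    · intro y
      exact ((h.hw1 y).add ((h.hw y).const_mul a)).congr_deriv (by ring)
    · intro y
      refine (abs_add_le _ _).trans (add_le_add (hw1b y) ?_)
      rw [abs_mul, abs_of_nonneg ha, abs_of_pos (h.pos y)]
      exact mul_le_mul_of_nonneg_left (hle y) ha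
  have hℓb : ℓ ^ (p-1) = b := by
    rw [pw_split hℓ0] at hc0
    have : ℓ * (b - ℓ ^ (p-1)) = 0 := by linarith
    rcases mul_eq_zero.1 this with h1 | h1
    · exact absurd h1 hℓ0.ne'
    · linarith
  have hG0 : ∀ y, 0 ≤ b * w y - w y ^ p := by
    intro y
    rw [pw_split (h.pos y)]
    have : w y ^ (p-1) ≤ b := by
      rw [← hℓb]; exact Real.rpow_le_rpow (h.pos y).le (hle y) hp1.le
    nlinarith [h.pos y]
  -- strict
  have hlt : ∀ y, w y < ℓ := by
    intro y1
    by_contra hcc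
    have heq : w y1 = ℓ := le_antisymm (hle y1) (not_lt.1 hcc)
    have hmax : IsLocalMax w y1 := Filter.Eventually.of_forall (fun y => by rw [heq]; exact hle y)
    have hw10 : w1 y1 = 0 := hmax.hasDerivAt_eq_zero (h.hw y1)
    have hK : Monotone (fun y => (w1 y ^ 2 + (ℓ - w y) ^ 2) * Real.exp ((2 * a + 1) * y)) := by
      have hd : ∀ y, HasDerivAt (fun y => (w1 y ^ 2 + (ℓ - w y) ^ 2) * Real.exp ((2 * a + 1) * y))
          ((2 * w1 y * (-a * w1 y + (b * w y - w y ^ p)) - 2 * (ℓ - w y) * w1 y + (2 * a + 1) * (w1 y ^ 2 + (ℓ - w y) ^ 2)) * Real.exp ((2 * a + 1) * y)) y := by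
        intro y
        have h1 := ((h.hw1 y).pow 2).add (((h.hw y).const_sub ℓ).pow 2)
        have h2 := ((hasDerivAt_id y).const_mul (2 * a + 1)).exp
        refine (h1.mul h2).congr_deriv ?_
        simp
        ring
      apply monotone_of_deriv_nonneg
      · exact fun y => (hd y).differentiableAt
      · intro y
        rw [(hd y).deriv]
        apply mul_nonneg _ (Real.exp_pos _).le
        nlinarith [mul_nonneg (hc y) (hG0 y), sq_nonneg (ℓ - w y - w1 y), mul_nonneg ha (sq_nonneg (ℓ - w y))]
    have hall : ∀ y ≤ y1, ℓ ≤ w y := by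
      intro y hy
      have h1 := hK hy
      simp only [hw10, heq] at h1
      norm_num at h1
      have h2 : w1 y ^ 2 + (ℓ - w y) ^ 2 ≤ 0 := by
        by_contra h3
        push Not at h3
        have := mul_pos h3 (Real.exp_pos ((2 * a + 1) * y))
        linarith
      nlinarith [sq_nonneg (w1 y), sq_nonneg (ℓ - w y)]
    have := ge_of_tendsto h.lim (eventually_atBot.2 ⟨y1, hall⟩)
    linarith
  -- slope
  have hdG : HasDerivAt (fun x => b * x - x ^ p) (b - p * ℓ ^ (p-1)) ℓ :=
    (((hasDerivAt_id ℓ).const_mul b).sub (Real.hasDerivAt_rpow_const (Or.inl hℓ0.ne'))).congr_deriv (by ring)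
  have hq : Tendsto (fun y => (b * w y - w y ^ p) / (ℓ - w y)) atTop (nhds ((p-1) * b)) := by
    have h1 : Tendsto w atTop (nhdsWithin ℓ {ℓ}ᶜ) :=
      tendsto_nhdsWithin_iff.2 ⟨hlim, Eventually.of_forall (fun y => (hlt y).ne)⟩
    have h2 := (hdG.tendsto_slope.comp h1).neg
    rw [hℓb] at h2
    refine (h2.congr ?_).trans_eq ?_
    · intro y
      simp only [Function.comp, slope_def_field, hc0, sub_zero]
      rw [← div_neg, neg_sub]
    · congr 1; ring
  set d := ((p-1) * b - a ^ 2 / 4) / 2 with hd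
  have hd0 : 0 < d := by simp only [hd]; linarith
  obtain ⟨Y, hY⟩ := eventually_atTop.1 (hq.eventually_const_le (show d + a^2/4 < (p-1)*b by simp only [hd]; linarith))
  set m := Real.sqrt d with hm
  have hm0 : 0 < m := Real.sqrt_pos.2 hd0
  have hmm : m ^ 2 = d := Real.sq_sqrt hd0.le
  have hmon : MonotoneOn (fun y => Real.arctan ((w1 y / (ℓ - w y) - a / 2) / m) - m * y) (Ici Y) := by
    have hdz : ∀ y, HasDerivAt (fun y => w1 y / (ℓ - w y))
        (-a * (w1 y / (ℓ - w y)) + (b * w y - w y ^ p) / (ℓ - w y) + (w1 y / (ℓ - w y)) ^ 2) y := by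
      intro y
      have hne : ℓ - w y ≠ 0 := by linarith [hlt y]
      refine ((h.hw1 y).div ((h.hw y).const_sub ℓ) hne).congr_deriv ?_
      field_simp
      ring
    refine mono_Ioc (f' := fun y => 1 / (1 + ((w1 y / (ℓ - w y) - a / 2) / m) ^ 2) *
      ((-a * (w1 y / (ℓ - w y)) + (b * w y - w y ^ p) / (ℓ - w y) + (w1 y / (ℓ - w y)) ^ 2) / m) - m) (convex_Ici Y) ?_ ?_
    · intro y _
      exact ((((hdz y).sub_const (a/2)).div_const m).arctan.sub ((hasDerivAt_id y).const_mul m)).congr_deriv (by ring)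
    · intro y hy
      have h1 := hY y hy
      set z := w1 y / (ℓ - w y)
      set q := (b * w y - w y ^ p) / (ℓ - w y)
      have h2 : 0 < 1 + ((z - a / 2) / m) ^ 2 := by positivity
      rw [sub_nonneg, one_div, inv_mul_eq_div, le_div_iff₀ h2, le_div_iff₀ hm0]
      have : m * (1 + ((z - a / 2) / m) ^ 2) * m = m ^ 2 + (z - a/2)^2 := by field_simp
      rw [this, hmm]
      nlinarith
  have hπ := Real.pi_pos
  have h1 := hmon (Set.mem_Ici.2 le_rfl) (show Y + π / m ∈ Ici Y from by simp; positivity) (by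
    have : 0 ≤ π / m := by positivity
    linarith)
  simp only at h1
  have e : m * (Y + π / m) = m * Y + π := by field_simp
  rw [e] at h1
  have h2 := Real.arctan_lt_pi_div_two ((w1 (Y + π / m) / (ℓ - w (Y + π / m)) - a / 2) / m)
  have h3 := Real.neg_pi_div_two_lt_arctan ((w1 Y / (ℓ - w Y) - a / 2) / m)
  linarith

lemma F_strict (hp : 1 < p) {M : ℝ} (hM : 0 < M) (hMb : b ≤ M ^ (p-1)) : StrictMonoOn (FF b p) (Ici M) := by
  apply strictMonoOn_of_deriv_pos (convex_Ici M)
  · exact fun x _ => (hdF hp x).continuousAt.continuousWithinAt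
  · intro x hx
    rw [interior_Ici] at hx
    have hx' : M < x := hx
    have hx0 : 0 < x := hM.trans hx'
    rw [(hdF hp x).deriv, pw_split hx0]
    have : M ^ (p-1) < x ^ (p-1) := Real.rpow_lt_rpow hM.le hx' (by linarith)
    nlinarith

lemma exists_peak (h : EF a b p w w1) (hab : a ^ 2 < 4 * ((p - 1) * b)) :
    ∃ y0, ∀ y > y0, w y < w y0 := by
  obtain ⟨y1, hy1⟩ := exists_decr h hab
  have hp := h.hp
  have hb := h.hb
  have hcw : Continuous w := continuous_iff_continuousAt.2 fun y => (h.hw y).continuousAt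
  obtain ⟨Y, hY⟩ := eventually_atBot.1 (h.lim.eventually_lt_const (h.pos y1))
  have hYy : Y < y1 := by
    by_contra hc
    exact absurd (hY y1 (not_lt.1 hc)) (lt_irrefl _)
  obtain ⟨m0, hm0, hm0'⟩ := isCompact_Icc.exists_isMaxOn (nonempty_Icc.2 hYy.le) hcw.continuousOn
  have hcomp : IsCompact (Icc Y y1 ∩ {y | w y = w m0}) :=
    isCompact_Icc.inter_right (isClosed_eq hcw continuous_const)
  obtain ⟨y0, ⟨hy0, hy0M⟩, hgr⟩ := hcomp.exists_isGreatest ⟨m0, hm0, rfl⟩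
  have hy0M' : w y0 = w m0 := hy0M
  have hmaxY : ∀ y ∈ Icc Y y1, w y ≤ w y0 := fun y hy => by rw [hy0M']; exact hm0' hy
  have hmax : ∀ y ≤ y1, w y ≤ w y0 := by
    intro y hy
    by_cases h1 : Y ≤ y
    · exact hmaxY y ⟨h1, hy⟩
    · exact (hY y (by linarith)).le.trans (hmaxY y1 ⟨hYy.le, le_rfl⟩)
  have hy01 : y0 < y1 := by
    rcases lt_or_eq_of_le hy0.2 with h1 | h1
    · exact h1
    · exfalso
      -- slope from left
      have := (h.hw y1).tendsto_slope.mono_left (nhdsWithin_mono y1 (s := Iio y1) (fun x hx => ne_of_lt hx))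
      obtain ⟨x, hx1, hx2⟩ := ((this.eventually_lt_const hy1).and self_mem_nhdsWithin).exists
      have hx2' : x < y1 := hx2
      have h3 := hmax x hx2'.le
      rw [h1] at h3
      rw [slope_def_field] at hx1
      have : 0 ≤ (w x - w y1) / (x - y1) := div_nonneg_of_nonpos (by linarith) (by linarith)
      linarith
  have hloc : IsLocalMax w y0 := by
    filter_upwards [Iio_mem_nhds hy01] with y hy using hmax y (le_of_lt hy)
  have hw10 : w1 y0 = 0 := hloc.hasDerivAt_eq_zero (h.hw y0)
  have hsec : b ≤ w y0 ^ (p-1) := by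
    have h1 := second_deriv_nonneg (f := fun y => - w y) (f' := fun y => - w1 y)
      (Eventually.of_forall fun s => (h.hw s).neg) (h.hw1 y0).neg hloc.neg
    rw [hw10, pw_split (h.pos y0)] at h1
    by_contra hc
    push Not at hc
    nlinarith [h.pos y0]
  have hM := h.pos y0
  have hF := F_strict hp hM hsec
  have hy1M : w y1 < w y0 := by
    rcases lt_or_eq_of_le (hmax y1 le_rfl) with h1 | h1
    · exact h1
    · have := hgr ⟨⟨hYy.le, le_rfl⟩, h1.trans hy0M'⟩
      linarith
  have hE0 : EE b p w w1 y0 = FF b p (w y0) := by unfold EE; rw [hw10]; ring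
  refine ⟨y0, fun y hy => ?_⟩
  by_contra hc
  push Not at hc
  have hEle := E_anti h (le_of_lt hy)
  rw [hE0] at hEle
  have heq : w y = w y0 := by
    by_contra hne
    have h1 : w y0 < w y := lt_of_le_of_ne hc (Ne.symm hne)
    have h2 := hF (Set.mem_Ici.2 le_rfl) (Set.mem_Ici.2 hc) h1
    unfold EE at hEle
    nlinarith [sq_nonneg (w1 y)]
  have hyy1 : y1 < y := by
    by_contra hcc
    push Not at hcc
    have := hgr ⟨⟨hy0.1.trans hy.le, hcc⟩, heq.trans hy0M'⟩
    linarith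
  have hEeq : EE b p w w1 y = FF b p (w y0) := by
    apply le_antisymm hEle
    unfold EE
    rw [heq]
    nlinarith [sq_nonneg (w1 y)]
  rcases eq_or_lt_of_le h.ha with ha | ha
  · -- a = 0
    obtain ⟨c, hc1, hc2⟩ := isCompact_Icc.exists_isMinOn (nonempty_Icc.2 hy.le) hcw.continuousOn
    have hcM : w c < w y0 := lt_of_le_of_lt (hc2 ⟨hy01.le, hyy1.le⟩) hy1M
    have hcy0 : y0 < c := lt_of_le_of_ne hc1.1 (fun e => by rw [e] at hcM; exact lt_irrefl _ hcM)
    have hcy : c < y := lt_of_le_of_ne hc1.2 (fun e => by rw [e, heq] at hcM; exact lt_irrefl _ hcM)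
    have hlocm : IsLocalMin w c := by
      filter_upwards [Ioo_mem_nhds hcy0 hcy] with z hz using hc2 (Ioo_subset_Icc_self hz)
    have hw1c := hlocm.hasDerivAt_eq_zero (h.hw c)
    have e1 := E_zero h ha.symm c
    have e2 := E_zero h ha.symm y0
    unfold EE at e1 e2
    rw [hw1c, Fx hp (h.pos c)] at e1
    rw [hw10, Fx hp (h.pos y0)] at e2
    have q1 : w c ^ (p-1) / (p+1) - b/2 = 0 := by
      have : w c ^ 2 * (w c ^ (p-1) / (p+1) - b/2) = 0 := by linarith
      exact (mul_eq_zero.1 this).resolve_left (pow_pos (h.pos c) 2).ne'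
    have q2 : w y0 ^ (p-1) / (p+1) - b/2 = 0 := by
      have : w y0 ^ 2 * (w y0 ^ (p-1) / (p+1) - b/2) = 0 := by linarith
      exact (mul_eq_zero.1 this).resolve_left (pow_pos (h.pos y0) 2).ne'
    have : w c ^ (p-1) < w y0 ^ (p-1) := Real.rpow_lt_rpow (h.pos c).le hcM (by linarith)
    have : w c ^ (p-1) / (p+1) < w y0 ^ (p-1) / (p+1) := div_lt_div_of_pos_right this (by linarith)
    linarith
  · have hconst : ∀ z ∈ Icc y0 y, EE b p w w1 z = FF b p (w y0) := fun z hz =>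
      le_antisymm (by rw [← hE0]; exact E_anti h hz.1) (by rw [← hEeq]; exact E_anti h hz.2)
    have h1 : HasDerivAt (EE b p w w1) 0 y1 := by
      apply (hasDerivAt_const y1 (FF b p (w y0))).congr_of_eventuallyEq
      filter_upwards [Ioo_mem_nhds hy01 hyy1] with x hx using hconst x (Ioo_subset_Icc_self hx)
    have h2 := (hdE h y1).unique h1
    nlinarith [mul_pos ha (mul_pos_of_neg_of_neg hy1 hy1)]

end C
end Inst

namespace Inst
section D
variable {n : ℕ} {p α : ℝ} {φ : ℝ → ℝ}

lemma p_gt_one (hn : 2 < n) (hpS : pS n ≤ p) : 1 < p := by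
  have hn' : (2:ℝ) < n := by exact_mod_cast hn
  refine lt_of_lt_of_le ?_ hpS
  unfold pS
  rw [lt_div_iff₀ (by linarith)]
  linarith

lemma nu_le (hn : 2 < n) (hpS : pS n ≤ p) : 2 * (2 / (p - 1)) ≤ (n:ℝ) - 2 := by
  have hn' : (2:ℝ) < n := by exact_mod_cast hn
  have hp := p_gt_one hn hpS
  unfold pS at hpS
  rw [div_le_iff₀ (by linarith)] at hpS
  rw [← mul_div_assoc, div_le_iff₀ (by linarith)]
  linarith

lemma algebra_cond (hn : 2 < n) (hpS : pS n ≤ p) (hpc : n ≤ 10 ∨ p < pc n) :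
    ((n:ℝ) - 2 - 2 * (2 / (p-1))) ^ 2 < 4 * ((p-1) * (2 / (p-1) * ((n:ℝ) - 2 - 2/(p-1)))) := by
  have hn' : (3:ℝ) ≤ n := by exact_mod_cast hn
  have hp := p_gt_one hn hpS
  have hν := nu_le hn hpS
  have hp1 : p - 1 ≠ 0 := by linarith
  have e : (p-1) * (2 / (p-1) * ((n:ℝ) - 2 - 2/(p-1))) = 2 * ((n:ℝ) - 2 - 2/(p-1)) := by
    field_simp
  rw [e]
  set ν := 2 / (p-1) with hνd
  have hν0 : 0 < ν := by apply div_pos <;> linarith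
  set S := Real.sqrt ((n:ℝ) - 1) with hS
  have hSS : S ^ 2 = (n:ℝ) - 1 := Real.sq_sqrt (by linarith)
  have hS1 : 1 < S := by
    rw [hS, Real.lt_sqrt (by norm_num)]; linarith
  -- |2ν - (n-4)| < 2 S
  have hup : 2 * ν - ((n:ℝ) - 4) < 2 * S := by linarith
  have hlow : (n:ℝ) - 4 - 2 * S < 2 * ν := by
    by_cases h10 : n ≤ 10
    · have h10' : (n:ℝ) ≤ 10 := by exact_mod_cast h10
      have : (n:ℝ) - 4 ≤ 2 * S := by
        nlinarith
      linarith
    · have hpc' := hpc.resolve_left h10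
      have h11 : (11:ℝ) ≤ n := by
        have : 11 ≤ n := by omega
        exact_mod_cast this
      unfold pc at hpc'
      rw [← hS, lt_div_iff₀ (by nlinarith)] at hpc'
      -- p (N)(n-10) < (n-2)^2 - 4n + 8 S
      have hpν : p = 1 + 2 / ν := by
        rw [hνd]; field_simp; ring
      by_contra hc
      push Not at hc
      have hD : 0 < (n:ℝ) - 4 - 2 * S := by linarith
      have h2 : 4 ≤ (p - 1) * ((n:ℝ) - 4 - 2 * S) := by
        have : 2 * ν * (p-1) = 4 := by rw [hνd]; field_simp; norm_num
        nlinarith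
      -- (n-2)(n-10) = (n-4-2S)(n-4+2S)
      have h3 : ((n:ℝ) - 2) * ((n:ℝ) - 10) = ((n:ℝ) - 4 - 2 * S) * ((n:ℝ) - 4 + 2 * S) := by
        nlinarith
      have h4 : 4 * ((n:ℝ) - 4 + 2 * S) ≤ (p-1) * (((n:ℝ) - 2) * ((n:ℝ) - 10)) := by
        rw [h3]
        have : 0 < (n:ℝ) - 4 + 2 * S := by linarith
        nlinarith
      nlinarith
  nlinarith [mul_pos (show 0 < 2 * S - (2 * ν - ((n:ℝ) - 4)) by linarith) (show 0 < 2 * S + (2 * ν - ((n:ℝ) - 4)) by linarith)]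

lemma ef_of (hφ : IsSteadyState n p α φ) (hn : 2 < n) (hpS : pS n ≤ p) :
    EF ((n:ℝ) - 2 - 2 * (2 / (p-1))) (2 / (p-1) * ((n:ℝ) - 2 - 2/(p-1))) p
      (fun y => Real.exp (2/(p-1) * y) * φ (Real.exp y))
      (fun y => Real.exp (2/(p-1) * y) * (2/(p-1) * φ (Real.exp y) + Real.exp y * deriv φ (Real.exp y))) := by
  have hp := p_gt_one hn hpS
  have hν := nu_le hn hpS
  have hν0 : 0 < 2 / (p-1) := by apply div_pos <;> linarith
  have hνp : 2 / (p-1) * p = 2 / (p-1) + 2 := by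
    have hp1 : p - 1 ≠ 0 := by linarith
    field_simp; ring
  set ν := 2 / (p-1)
  refine ⟨by linarith, mul_pos hν0 (by linarith), hp, ?_, ?_, ?_, ?_⟩
  · intro y
    have h1 := ((hasDerivAt_id y).const_mul ν).exp
    have h2 := (hd1 hφ (Real.exp_pos y)).comp y (Real.hasDerivAt_exp y)
    refine (h1.mul h2).congr_deriv ?_
    simp
    ring
  · intro y
    have hr := Real.exp_pos y
    have h1 := ((hasDerivAt_id y).const_mul ν).exp
    have h2 := (hd1 hφ hr).comp y (Real.hasDerivAt_exp y)
    have h3 := (hd2 hφ hr).comp y (Real.hasDerivAt_exp y)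
    refine (h1.mul ((h2.const_mul ν).add ((Real.hasDerivAt_exp y).mul h3))).congr_deriv ?_
    have e1 : (Real.exp (ν * y) * φ (Real.exp y)) ^ p = Real.exp (ν * y) * (Real.exp y) ^ 2 * φ (Real.exp y) ^ p := by
      rw [Real.mul_rpow (Real.exp_pos _).le (hφ.pos _ hr.le).le, ← Real.exp_mul,
        show ν * y * p = ν * y + y * 2 by linear_combination y * hνp, Real.exp_add, ← Real.exp_nat_mul]
      congr 3; push_cast; ring
    rw [e1]
    simp
    field_simp
    ring
  · intro y; exact mul_pos (Real.exp_pos _) (hφ.pos _ (Real.exp_pos _).le)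
  · have h1 : Tendsto (fun y => Real.exp (ν * y) * α) atBot (nhds (0 * α)) := by
      apply Tendsto.mul_const
      exact Real.tendsto_exp_atBot.comp (tendsto_id.const_mul_atBot hν0)
    rw [zero_mul] at h1
    refine tendsto_of_tendsto_of_tendsto_of_le_of_le tendsto_const_nhds h1 ?_ ?_
    · intro y; exact (mul_pos (Real.exp_pos _) (hφ.pos _ (Real.exp_pos _).le)).le
    · intro y; exact mul_le_mul_of_nonneg_left (phi_le hφ (Real.exp_pos _).le) (Real.exp_pos _).le

lemma exists_r0 (hφ : IsSteadyState n p α φ) (hn : 2 < n) (hpS : pS n ≤ p) (hpc : n ≤ 10 ∨ p < pc n) :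
    ∃ r0 > 0, ∀ μ > 1, μ ^ (2 / (p-1)) * φ (μ * r0) < φ r0 := by
  obtain ⟨y0, hy0⟩ := exists_peak (ef_of hφ hn hpS) (algebra_cond hn hpS hpc)
  refine ⟨Real.exp y0, Real.exp_pos _, fun μ hμ => ?_⟩
  have hμ0 : 0 < μ := by linarith
  have h := hy0 (Real.log μ + y0) (by linarith [Real.log_pos hμ])
  rw [mul_add, Real.exp_add, Real.exp_add, Real.exp_log hμ0] at h
  have e : μ ^ (2 / (p-1)) = Real.exp (2 / (p-1) * Real.log μ) := by
    rw [Real.rpow_def_of_pos hμ0, mul_comm]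
  rw [e]
  have hE := Real.exp_pos (2 / (p-1) * y0)
  by_contra hc
  push Not at hc
  nlinarith

lemma theta_lower (hφ : IsSteadyState n p α φ) (hn : 2 < n) (hpS : pS n ≤ p) :
    ∃ θ > 0, ∀ r ≥ 1, θ * φ r ≤ - (r * deriv φ r) := by
  have hef := ef_of hφ hn hpS
  have hp := p_gt_one hn hpS
  have hn0 : (0:ℝ) < n := by positivity
  have hν0 : 0 < 2 / (p-1) := by apply div_pos <;> linarith
  rcases eq_or_lt_of_le hef.ha with ha | ha
  · have h := ratio_anti hef ha.symm
    refine ⟨- deriv φ 1 / φ 1, div_pos (by linarith [d1_neg hφ hn hp one_pos]) (hφ.pos 1 zero_le_one), fun r hr => ?_⟩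
    have hr0 : 0 < r := by linarith
    have h1 := h (Real.log_nonneg hr)
    simp only [Real.exp_log hr0, Real.exp_zero] at h1
    rw [mul_div_mul_left _ _ (Real.exp_pos _).ne', mul_div_mul_left _ _ (Real.exp_pos _).ne', add_div, add_div,
      mul_div_cancel_right₀ _ (hφ.pos r hr0.le).ne', mul_div_cancel_right₀ _ (hφ.pos 1 zero_le_one).ne', one_mul] at h1
    have h2 : r * deriv φ r / φ r ≤ deriv φ 1 / φ 1 := by linarith
    rw [div_le_iff₀ (hφ.pos r hr0.le)] at h2
    rw [neg_div]
    linarith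
  · obtain ⟨w0, hw0, hw⟩ := w_lower hef ha
    refine ⟨w0 ^ (p-1) / n, by positivity, fun r hr => ?_⟩
    have hr0 : 0 < r := by linarith
    have h1 := hw (Real.log r) (Real.log_nonneg hr)
    simp only [Real.exp_log hr0] at h1
    have h2 := Real.rpow_le_rpow hw0.le h1 (show 0 ≤ p - 1 by linarith)
    have hφr := hφ.pos r hr0.le
    rw [Real.mul_rpow (Real.exp_pos _).le hφr.le, ← Real.exp_mul,
      show 2 / (p-1) * Real.log r * (p-1) = Real.log r + Real.log r by
        have hp1 : p - 1 ≠ 0 := by linarith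
        field_simp; ring, Real.exp_add, Real.exp_log hr0] at h2
    have h3 := d1_upper hφ hn hp hr0
    rw [pw_split hφr] at h3
    rw [div_mul_eq_mul_div, div_le_iff₀ hn0]
    calc w0 ^ (p-1) * φ r ≤ r * r * φ r ^ (p-1) * φ r := by gcongr
      _ = r * (r * (φ r * φ r ^ (p-1))) := by ring
      _ ≤ r * (n * - deriv φ r) := by gcongr
      _ = _ := by ring

lemma grad_lower (hφ : IsSteadyState n p α φ) (hn : 2 < n) (hpS : pS n ≤ p) :
    ∃ c > 0, ∀ r ≥ 1, c * (φ r * φ r ^ p) ≤ deriv φ r ^ 2 := by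
  obtain ⟨θ, hθ, h⟩ := theta_lower hφ hn hpS
  have hp := p_gt_one hn hpS
  have hn0 : (0:ℝ) < n := by positivity
  refine ⟨θ / n, by positivity, fun r hr => ?_⟩
  have hr0 : 0 < r := by linarith
  have h1 := h r hr
  have h2 := d1_upper hφ hn hp hr0
  have hφr := hφ.pos r hr0.le
  have hφp : 0 < φ r ^ p := Real.rpow_pos_of_pos hφr _
  have h3 : (θ * φ r) * (r * φ r ^ p) ≤ (-(r * deriv φ r)) * (n * (- deriv φ r)) :=
    mul_le_mul h1 h2 (by positivity) ((by positivity : 0 ≤ θ * φ r).trans h1)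
  rw [div_mul_eq_mul_div, div_le_iff₀ hn0]
  have h4 : r * (θ * (φ r * φ r ^ p)) ≤ r * (deriv φ r ^ 2 * n) := by nlinarith
  exact le_of_mul_le_mul_left h4 hr0

end D
end Inst

namespace Inst
section E
variable {n : ℕ} {p α : ℝ} {φ : ℝ → ℝ}

/-- lower one-dimensional jets -/
structure SubJet (n : ℕ) (F : EuclideanSpace ℝ (Fin n) → ℝ) (x : EuclideanSpace ℝ (Fin n))
    (g g' : Fin n → ℝ → ℝ) (d : Fin n → ℝ) : Prop where
  h1 : ∀ i, ∀ᶠ s in nhds (0:ℝ), HasDerivAt (g i) (g' i s) s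
  h2 : ∀ i, HasDerivAt (g' i) (d i) 0
  h0 : ∀ i, g i 0 = F x
  le : ∀ i, ∀ᶠ s in nhds (0:ℝ), g i s ≤ F (x + s • EuclideanSpace.single i (1:ℝ))

lemma SubJet.comp {F G : EuclideanSpace ℝ (Fin n) → ℝ} {x : EuclideanSpace ℝ (Fin n)}
    {g g' : Fin n → ℝ → ℝ} {d : Fin n → ℝ} (h : SubJet n F x g g' d)
    {J J' : ℝ → ℝ} {J2 a : ℝ} (ha : a < F x) (hJ1 : ∀ q > a, HasDerivAt J (J' q) q)
    (hJ2 : HasDerivAt J' J2 (F x)) (hmono : MonotoneOn J (Ioi a))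
    (hG : ∀ y, a < F y → J (F y) ≤ G y) (hGx : G x = J (F x)) :
    SubJet n G x (fun i s => J (g i s)) (fun i s => J' (g i s) * g' i s)
      (fun i => J2 * g' i 0 ^ 2 + J' (F x) * d i) := by
  have hc : ∀ i, ∀ᶠ s in nhds (0:ℝ), a < g i s := fun i => by
    have hh := ((h.h1 i).self_of_nhds).continuousAt
    apply hh.eventually_const_lt
    rw [h.h0]; exact ha
  refine ⟨fun i => ?_, fun i => ?_, fun i => ?_, fun i => ?_⟩
  · filter_upwards [h.h1 i, hc i] with s hs hs2
    exact (hJ1 _ hs2).comp s hs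
  · have e : HasDerivAt J' J2 (g i 0) := by rw [h.h0]; exact hJ2
    have := (e.comp 0 ((h.h1 i).self_of_nhds)).mul (h.h2 i)
    refine this.congr_deriv ?_
    simp only [Function.comp, h.h0 i]
    ring
  · simp only [h.h0, hGx]
  · filter_upwards [hc i, h.le i] with s hs hs2
    exact (hmono hs (lt_of_lt_of_le hs hs2) hs2).trans (hG _ (lt_of_lt_of_le hs hs2))

lemma left_deriv_nonpos {k : ℝ → ℝ} {c t : ℝ} (hk : HasDerivAt k c t) (h0 : k t = 0)
    (h : ∀ᶠ τ in nhdsWithin t (Iio t), 0 ≤ k τ) : c ≤ 0 := by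
  have h1 := (hasDerivWithinAt_iff_tendsto_slope' (s := Iio t) (x := t) (by simp)).1 hk.hasDerivWithinAt
  refine le_of_tendsto h1 ?_
  filter_upwards [h, self_mem_nhdsWithin] with τ hτ hτ2
  rw [slope_def_field, h0]
  apply div_nonpos_of_nonneg_of_nonpos
  · linarith
  · have : τ < t := hτ2
    linarith

lemma touch {v : EuclideanSpace ℝ (Fin n) → ℝ → ℝ} {v₀ : EuclideanSpace ℝ (Fin n) → ℝ}
    (hv : IsBddClassicalSol n p v v₀) (hp : 1 < p) {Z : EuclideanSpace ℝ (Fin n) → ℝ → ℝ}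
    {x : EuclideanSpace ℝ (Fin n)} {t zt : ℝ} (ht : 0 < t)
    {g g' : Fin n → ℝ → ℝ} {d : Fin n → ℝ} (hj : SubJet n (fun y => Z y t) x g g' d)
    (hx : ∀ᶠ y in nhds x, Z y t - v y t ≤ Z x t - v x t)
    (hτ : ∀ᶠ τ in nhdsWithin t (Iio t), Z x τ - v x τ ≤ Z x t - v x t)
    (hz : HasDerivAt (Z x) zt t)
    (hu : ∀ᶠ τ in nhdsWithin t (Iio t), 0 ≤ v x t + (Z x τ - Z x t)) :
    ∑ i, d i + v x t ^ p ≤ p * v x t ^ (p-1) * zt := by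
  have hlap : ∑ i, d i ≤ lap n (fun y => v y t) x := by
    unfold lap
    apply Finset.sum_le_sum
    intro i _
    have hs := hv.smooth_space t ht
    set f := fun y => v y t with hf
    set e : EuclideanSpace ℝ (Fin n) := EuclideanSpace.single i (1:ℝ) with he
    have hl : ∀ s : ℝ, HasDerivAt (fun s : ℝ => x + s • e) e s := fun s => by
      have := ((hasDerivAt_id s).smul_const e).const_add x
      simpa using this
    have hd : ∀ s : ℝ, HasDerivAt (fun s : ℝ => f (x + s • e)) (fderiv ℝ f (x + s • e) e) s := fun s => by
      have h1 : HasFDerivAt f (fderiv ℝ f (x + s • e)) (x + s • e) :=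
        ((hs.differentiable (by norm_num)) (x + s • e)).hasFDerivAt
      exact HasFDerivAt.comp_hasDerivAt (l := f) (f := fun s : ℝ => x + s • e) s h1 (hl s)
    have hdd : ContDiff ℝ 1 (fun y => fderiv ℝ f y e) :=
      (hs.fderiv_right (m := 1) (by norm_num)).clm_apply contDiff_const
    have hd2 : HasDerivAt (fun s : ℝ => fderiv ℝ f (x + s • e) e)
        (fderiv ℝ (fun y => fderiv ℝ f y e) x e) 0 := by
      have h1 : HasFDerivAt (fun y => fderiv ℝ f y e) (fderiv ℝ (fun y => fderiv ℝ f y e) x) (x + (0:ℝ) • e) := by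
        have := ((hdd.differentiable (by norm_num)) x).hasFDerivAt
        simpa using this
      exact HasFDerivAt.comp_hasDerivAt (l := fun y => fderiv ℝ f y e) (f := fun s : ℝ => x + s • e) 0 h1 (hl 0)
    have key := second_deriv_nonneg (f := fun s => f (x + s • e) - g i s)
      (f' := fun s => fderiv ℝ f (x + s • e) e - g' i s) (x := 0)
      (by filter_upwards [hj.h1 i] with s hs1; exact (hd s).sub hs1) (hd2.sub (hj.h2 i)) ?_
    · linarith
    · have hc : Tendsto (fun s : ℝ => x + s • e) (nhds 0) (nhds x) := by
        have := (hl 0).continuousAt.tendsto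
        simpa using this
      filter_upwards [hc.eventually hx, hj.le i] with s hs1 hs2
      have h0 := hj.h0 i
      simp only [zero_smul, add_zero, h0, hf]
      linarith
  have htime : deriv (fun s => v x s ^ p) t ≤ p * v x t ^ (p-1) * zt := by
    have hd : HasDerivAt (fun s => v x s ^ p) (deriv (fun s => v x s ^ p) t) t :=
      (((hv.smooth_time x).differentiableOn (by norm_num)).differentiableAt (Ioi_mem_nhds ht)).hasDerivAt
    have hu1 : HasDerivAt (fun τ => v x t + (Z x τ - Z x t)) zt t :=
      (hz.sub_const _).const_add _
    have hu2 := hu1.rpow_const (p := p) (Or.inr hp.le)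
    have := left_deriv_nonpos (hd.sub hu2) (by simp) ?_
    · simp only [sub_self, add_zero] at this
      linarith
    · filter_upwards [hτ, hu] with τ h1 h2
      have := Real.rpow_le_rpow h2 (show v x t + (Z x τ - Z x t) ≤ v x τ by linarith) (by linarith : 0 ≤ p)
      simpa using this
  have := hv.pde x t ht
  linarith

lemma first_touch {X : Type*} [TopologicalSpace X] [T2Space X] {C : Set X} (hC : IsCompact C) {h : X → ℝ → ℝ} {a T ε : ℝ}
    (hh : ContinuousOn (fun q : X × ℝ => h q.1 q.2) (C ×ˢ Icc a T))
    (h0 : ∀ x ∈ C, h x a < ε) (h1 : ∃ x ∈ C, ∃ t ∈ Icc a T, ε ≤ h x t) :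
    ∃ x ∈ C, ∃ t, a < t ∧ t ≤ T ∧ h x t = ε ∧ ∀ y ∈ C, ∀ s ∈ Icc a t, h y s ≤ ε := by
  have hK : IsCompact (C ×ˢ Icc a T) := hC.prod isCompact_Icc
  set S := (C ×ˢ Icc a T) ∩ (fun q : X × ℝ => h q.1 q.2) ⁻¹' Ici ε with hS
  have hSc : IsCompact S :=
    hK.of_isClosed_subset (hh.preimage_isClosed_of_isClosed hK.isClosed isClosed_Ici) inter_subset_left
  have hne : S.Nonempty := by
    obtain ⟨x, hx, t, ht, h⟩ := h1
    exact ⟨(x, t), ⟨hx, ht⟩, h⟩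
  obtain ⟨⟨x, t⟩, hxt, hmin⟩ := hSc.exists_isMinOn hne continuous_snd.continuousOn
  obtain ⟨⟨hxC, htI⟩, hge⟩ := hxt
  have hge : ε ≤ h x t := hge
  simp only at hxC htI
  have hlt : ∀ y ∈ C, ∀ s ∈ Ico a t, h y s < ε := by
    intro y hy s hs
    by_contra hcon
    push Not at hcon
    have := hmin (show (y, s) ∈ S from ⟨⟨hy, hs.1, hs.2.le.trans htI.2⟩, hcon⟩)
    have : t ≤ s := this
    linarith [hs.2]
  have hat : a < t := by
    rcases eq_or_lt_of_le htI.1 with e | e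
    · rw [← e] at hge; linarith [h0 x hxC]
    · exact e
  have hle : ∀ y ∈ C, h y t ≤ ε := by
    intro y hy
    have hc : ContinuousWithinAt (fun s => h y s) (Ico a t) t := by
      have : ContinuousOn (fun s => h y s) (Icc a T) :=
        hh.comp (f := fun s => (y, s)) (by fun_prop) (fun s hs => ⟨hy, hs⟩)
      exact (this t htI).mono (fun s hs => ⟨hs.1, hs.2.le.trans htI.2⟩)
    have : (nhdsWithin t (Ico a t)).NeBot := by
      rw [← mem_closure_iff_nhdsWithin_neBot, closure_Ico hat.ne]
      exact ⟨hat.le, le_rfl⟩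
    refine le_of_tendsto hc ?_
    filter_upwards [self_mem_nhdsWithin] with s hs
    exact (hlt y hy s hs).le
  refine ⟨x, hxC, t, hat, htI.2, le_antisymm (hle x hxC) hge, fun y hy s hs => ?_⟩
  rcases eq_or_lt_of_le hs.2 with e | e
  · rw [e]; exact hle y hy
  · exact (hlt y hy s ⟨hs.1, e⟩).le

lemma norm_line_sq (x : EuclideanSpace ℝ (Fin n)) (i : Fin n) (s : ℝ) :
    ‖x + s • EuclideanSpace.single i (1:ℝ)‖ ^ 2 = ‖x‖^2 + 2 * s * x i + s^2 := by
  rw [norm_add_sq_real, inner_smul_right, EuclideanSpace.inner_single_right, norm_smul]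
  simp
  ring

lemma phi_jet (hφ : IsSteadyState n p α φ) (hn : 2 < n) (hp : 1 < p) (x : EuclideanSpace ℝ (Fin n)) :
    ∃ g g' : Fin n → ℝ → ℝ, ∃ d : Fin n → ℝ, SubJet n (fun y => φ ‖y‖) x g g' d ∧
      ∑ i, d i = - φ ‖x‖ ^ p ∧ (x ≠ 0 → ∑ i, g' i 0 ^ 2 = deriv φ ‖x‖ ^ 2) := by
  have hn0 : (0:ℝ) < n := by positivity
  by_cases hx : x = 0
  · subst hx
    refine ⟨fun i s => α - α^p/(2*n)*s^2, fun i s => - (α^p/n*s), fun i => - (α^p/n), ⟨?_, ?_, ?_, ?_⟩, ?_, fun h => absurd rfl h⟩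
    · intro i
      refine Eventually.of_forall fun s => ?_
      refine (((hasDerivAt_pow 2 s).const_mul (α^p/(2*n))).const_sub α).congr_deriv ?_
      field_simp
      simp
    · intro i
      refine (((hasDerivAt_id (0:ℝ)).const_mul (α^p/n)).neg).congr_deriv (by simp)
    · intro i; simp [hφ.val0]
    · intro i
      refine Eventually.of_forall fun s => ?_
      have := phi_lower hφ hn hp (norm_nonneg ((0 : EuclideanSpace ℝ (Fin n)) + s • EuclideanSpace.single i (1:ℝ)))
      rw [norm_line_sq] at this
      simpa using this
    · simp [hφ.val0]
      field_simp
  · have hr : 0 < ‖x‖ := norm_pos_iff.2 hx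
    set r := ‖x‖ with hrdef
    have hsum : ∑ i, x i ^ 2 = r ^ 2 := by
      rw [hrdef, EuclideanSpace.norm_sq_eq]; simp
    set R : Fin n → ℝ → ℝ := fun i s => ‖x + s • EuclideanSpace.single i (1:ℝ)‖ with hR
    have hR2 : ∀ i s, R i s ^ 2 = r^2 + 2 * s * x i + s^2 := fun i s => norm_line_sq x i s
    have hRe : ∀ i s, R i s = √(r^2 + 2 * s * x i + s^2) := fun i s => by
      rw [← hR2, Real.sqrt_sq (norm_nonneg _)]
    have hR0 : ∀ i, R i 0 = r := fun i => by simp [hR, hrdef]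
    have hRc : ∀ i, Continuous (R i) := fun i => by simp only [hR]; fun_prop
    have hRpos : ∀ i, ∀ᶠ s in nhds (0:ℝ), 0 < R i s := fun i => by
      apply (hRc i).continuousAt.eventually_const_lt
      rw [hR0]; exact hr
    have hRd : ∀ i s, 0 < R i s → HasDerivAt (R i) ((x i + s) / R i s) s := fun i s hs => by
      have h1 : HasDerivAt (fun s => r^2 + 2 * s * x i + s^2) (2 * x i + 2 * s) s := by
        have := ((((hasDerivAt_id s).const_mul 2).mul_const (x i)).const_add (r^2)).add (hasDerivAt_pow 2 s)
        exact this.congr_deriv (by simp)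
      have hne : r^2 + 2 * s * x i + s^2 ≠ 0 := by rw [← hR2]; positivity
      have h2 := h1.sqrt hne
      have e : R i = fun s => √(r^2 + 2 * s * x i + s^2) := funext (hRe i)
      rw [← hRe] at h2
      rw [← e] at h2
      refine h2.congr_deriv ?_
      field_simp
    refine ⟨fun i s => φ (R i s), fun i s => deriv φ (R i s) * ((x i + s) / R i s),
      fun i => (-((n:ℝ)-1)/r * deriv φ r - φ r ^ p) * (x i / r) ^ 2 + deriv φ r * (1 / r - x i ^ 2 / r^3), ⟨?_, ?_, ?_, ?_⟩, ?_, fun _ => ?_⟩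
    · intro i
      filter_upwards [hRpos i] with s hs
      exact (hd1 hφ hs).comp s (hRd i s hs)
    · intro i
      have hp0 : 0 < R i 0 := by rw [hR0]; exact hr
      have h1 := ((hd2 hφ hp0).comp (0:ℝ) (hRd i 0 hp0)).mul
        ((((hasDerivAt_id (0:ℝ)).const_add (x i))).div (hRd i 0 hp0) hp0.ne')
      refine h1.congr_deriv ?_
      simp only [hR0, Function.comp, id, add_zero, Pi.div_apply]
      field_simp
    · intro i; simp only [hR0]; rfl
    · intro i; exact Eventually.of_forall fun s => le_rfl
    · rw [Finset.sum_add_distrib, ← Finset.mul_sum, ← Finset.mul_sum, Finset.sum_sub_distrib]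
      simp only [div_pow, ← Finset.sum_div, hsum]
      simp
      field_simp
      ring
    · simp only [hR0, add_zero, mul_pow, div_pow]
      rw [← Finset.mul_sum, ← Finset.sum_div, hsum]
      field_simp

end E
end Inst

namespace Inst
section F
variable {n : ℕ} {p α : ℝ} {φ : ℝ → ℝ}

lemma algA {c q P S κ s0 : ℝ} (hc : 0 < c) (hq : 0 < q) (hP : 0 < P) (hS : c * (q * P) ≤ S)
    (hκ0 : 0 < κ) (hκ : κ < q) (hs : 1 - κ / q < s0) (hs1 : s0 ≤ 1/2) (hs2 : s0 ≤ c / 4) :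
    0 < 2 * κ^2 / q^3 * S - (1 - κ^2/q^2) * P := by
  obtain ⟨σ, hσ⟩ : ∃ σ, σ = κ / q := ⟨_, rfl⟩
  have hκq : κ = σ * q := by rw [hσ]; field_simp
  rw [← hσ] at hs
  have hσ1 : σ < 1 := by rw [hσ, div_lt_one hq]; exact hκ
  subst hκq
  have h1 : 2 * (σ * q)^2 / q^3 * (c * (q * P)) ≤ 2 * (σ * q)^2 / q^3 * S := by gcongr
  have h2 : 2 * (σ * q)^2 / q^3 * (c * (q * P)) = 2 * c * σ^2 * P := by field_simp
  have h3 : (σ*q)^2/q^2 = σ^2 := by field_simp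
  rw [h3]
  have h4 : 1/4 < σ^2 := by nlinarith
  have h5 : 1 - σ^2 < 2 * s0 := by nlinarith
  have h6 : c / 2 < 2 * c * σ^2 := by nlinarith
  have h7 : 0 < (2 * c * σ^2 - (1 - σ^2)) * P := mul_pos (by linarith) hP
  linarith

lemma algB {q κ s0 K ϑ ρ v : ℝ} (hp : 1 < p) (hκ0 : 0 < κ) (hκ : κ < q) (hs0 : 0 < s0) (hs : s0 ≤ 1 - κ / q)
    (hK : K * (2 * p * (s0 * (s0^2)^(p-1))) = 2 * p + 1) (hϑ0 : 0 < ϑ) (hϑ1 : ϑ < 1) (hρ : ϑ^p * (1 + ρ) ≥ 1)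
    (hρκ : ρ ≤ κ / q) (hv : ϑ * ((q-κ)^2/q) ≤ v) :
    0 < - (1 - κ^2/q^2) * q^p + v^p - p * v^(p-1) * (2 * (q - κ) * (-(κ * K)) / q) := by
  have hq : 0 < q := by linarith
  obtain ⟨σ, hσ⟩ : ∃ σ, σ = κ / q := ⟨_, rfl⟩
  have hκq : κ = σ * q := by rw [hσ]; field_simp
  rw [← hσ] at hs hρκ
  have hσ1 : σ < 1 := by rw [hσ, div_lt_one hq]; exact hκ
  have hσ0 : 0 < σ := by rw [hσ]; positivity
  obtain ⟨s, hsd⟩ : ∃ s, s = 1 - σ := ⟨_, rfl⟩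
  rw [← hsd] at hs
  have hsp : 0 < s := by linarith
  have hKp : 0 < K := by
    by_contra hcon
    push Not at hcon
    have : 0 < 2 * p * (s0 * (s0^2)^(p-1)) := by positivity
    nlinarith
  have e1 : (q - κ)^2/q = q * s^2 := by rw [hκq, hsd]; field_simp
  have e2 : 2 * (q - κ) * (-(κ * K)) / q = -(2 * q * s * σ * K) := by rw [hκq, hsd]; field_simp
  have e3 : κ^2/q^2 = σ^2 := by rw [hκq]; field_simp
  rw [e1] at hv
  rw [e2, e3]
  have hP : 0 < q^p := by positivity
  have hz : 0 < q * s^2 := by positivity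
  have hv1 : ϑ^p * (q^p * (s^2)^p) ≤ v^p := by
    rw [← Real.mul_rpow hq.le (by positivity), ← Real.mul_rpow hϑ0.le hz.le]
    exact Real.rpow_le_rpow (by positivity) hv (by linarith)
  have hv2 : ϑ^p * (q^(p-1) * (s^2)^(p-1)) ≤ v^(p-1) := by
    have h1 : ϑ^p ≤ ϑ^(p-1) := Real.rpow_le_rpow_of_exponent_ge hϑ0 hϑ1.le (by linarith)
    calc ϑ^p * (q^(p-1) * (s^2)^(p-1)) ≤ ϑ^(p-1) * (q^(p-1) * (s^2)^(p-1)) := by gcongr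
      _ = (ϑ * (q * s^2))^(p-1) := by
        rw [Real.mul_rpow hϑ0.le hz.le, Real.mul_rpow hq.le (by positivity)]
      _ ≤ _ := Real.rpow_le_rpow (by positivity) hv (by linarith)
  have hB1 : 1 - 2 * p * σ ≤ (s^2)^p := by
    have := one_add_mul_self_le_rpow_one_add (s := s^2 - 1) (by nlinarith) hp.le
    rw [add_sub_cancel] at this
    have h2 : s^2 - 1 ≥ - (2 * σ) := by rw [hsd]; nlinarith
    nlinarith
  have hB2 : 2 * p + 1 ≤ K * (2 * p * (s * (s^2)^(p-1))) := by
    rw [← hK]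
    have : (s0^2)^(p-1) ≤ (s^2)^(p-1) := Real.rpow_le_rpow (by positivity) (by gcongr) (by linarith)
    gcongr
  have hB : 1 + ρ ≤ (s^2)^p + σ * (K * (2 * p * (s * (s^2)^(p-1)))) := by nlinarith
  have hq1 : q^p = q * q^(p-1) := pw_split hq
  have hfin : ϑ^p * (1 + ρ) ≤ ϑ^p * ((s^2)^p + σ * (K * (2 * p * (s * (s^2)^(p-1))))) := by gcongr
  have h5 : p * (ϑ^p * (q^(p-1) * (s^2)^(p-1))) * (2 * q * s * σ * K) ≤ p * v^(p-1) * (2 * q * s * σ * K) := by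
    gcongr
  have h6 : q^p * 1 ≤ q^p * (ϑ^p * ((s^2)^p + σ * (K * (2 * p * (s * (s^2)^(p-1)))))) := by
    gcongr; linarith
  have h7 : q^p * (ϑ^p * ((s^2)^p + σ * (K * (2 * p * (s * (s^2)^(p-1)))))) =
     ϑ^p * (q^p * (s^2)^p) + p * (ϑ^p * (q^(p-1) * (s^2)^(p-1))) * (2 * q * s * σ * K) := by
    rw [hq1]; ring
  have h8 : 0 < σ^2 * q^p := by positivity
  linarith

lemma core1 (hφ : IsSteadyState n p α φ) (hn : 2 < n) (hp : 1 < p) (hα : 0 < α)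
    {v : EuclideanSpace ℝ (Fin n) → ℝ → ℝ} {v₀ : EuclideanSpace ℝ (Fin n) → ℝ}
    (hv : IsBddClassicalSol n p v v₀) (hge : ∀ x : EuclideanSpace ℝ (Fin n), φ ‖x‖ ≤ v₀ x)
    {c s0 K κ0 T : ℝ} (hc : 0 < c) (hgr : ∀ r ≥ 1, c * (φ r * φ r ^ p) ≤ deriv φ r ^ 2)
    (hs0 : 0 < s0) (hs1 : s0 ≤ 1/2) (hs2 : s0 ≤ c / 4)
    (hK : K * (2 * p * (s0 * (s0^2)^(p-1))) = 2 * p + 1) (hκ0 : 0 < κ0) (hT : 0 ≤ T)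
    (hκT : κ0 * Real.exp (K * T) < φ 1 / 2) (x1 : EuclideanSpace ℝ (Fin n)) :
    (max (φ ‖x1‖ - κ0 * Real.exp (K * T)) 0)^2 / φ ‖x1‖ ≤ v x1 T := by
  have hKp : 0 < K := by
    by_contra hcon
    push Not at hcon
    have : 0 < 2 * p * (s0 * (s0^2)^(p-1)) := by positivity
    nlinarith
  set κ : ℝ → ℝ := fun t => κ0 * Real.exp (K * t) with hκdef
  have hκpos : ∀ t, 0 < κ t := fun t => by simp only [hκdef]; positivity
  have hκmono : Monotone κ := fun a b hab => by simp only [hκdef]; gcongr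
  have hκge : ∀ t ≥ 0, κ0 ≤ κ t := fun t ht => by
    have := hκmono ht
    simpa [hκdef] using this
  have hκc : Continuous κ := by simp only [hκdef]; fun_prop
  have hφpos : ∀ y : EuclideanSpace ℝ (Fin n), 0 < φ ‖y‖ := fun y => hφ.pos _ (norm_nonneg y)
  set z : EuclideanSpace ℝ (Fin n) → ℝ → ℝ := fun y t => (max (φ ‖y‖ - κ t) 0)^2 / φ ‖y‖ with hz
  have hz0 : ∀ y t, φ ‖y‖ ≤ κ t → z y t = 0 := fun y t h => by
    simp only [hz]
    rw [max_eq_right (by linarith)]; simp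
  have hz1 : ∀ y t, κ t ≤ φ ‖y‖ → z y t = (φ ‖y‖ - κ t)^2 / φ ‖y‖ := fun y t h => by
    simp only [hz]
    rw [max_eq_left (by linarith)]
  have hzanti : ∀ y, Antitone (z y) := fun y a b hab => by
    have h1 := hκmono hab
    have h2 := hφpos y
    simp only [hz]
    gcongr
  have hzle : ∀ y, z y 0 ≤ φ ‖y‖ := fun y => by
    have h2 := hφpos y
    simp only [hz]
    rw [div_le_iff₀ h2, ← sq]
    have := hκpos 0
    have : max (φ ‖y‖ - κ 0) 0 ≤ φ ‖y‖ := max_le (by linarith) h2.le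
    gcongr
  change z x1 T ≤ v x1 T
  by_contra hcon
  push Not at hcon
  -- choice of parameters
  set ϑ : ℝ := (1 + κ0/α) ^ (-1/p : ℝ) with hϑ
  have hb : 1 < 1 + κ0/α := by have : 0 < κ0/α := by positivity
                               linarith
  have hϑ0 : 0 < ϑ := by positivity
  have hϑ1 : ϑ < 1 := Real.rpow_lt_one_of_one_lt_of_neg hb (div_neg_of_neg_of_pos (by norm_num) (by linarith))
  have hϑp : ϑ^p * (1 + κ0/α) ≥ 1 := by
    rw [hϑ, ← Real.rpow_mul (by linarith), div_mul_cancel₀ _ (by linarith : p ≠ 0), Real.rpow_neg_one, inv_mul_cancel₀ (by linarith)]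
  set ε := min (z x1 T - v x1 T) ((1-ϑ) * (κ0 * s0^2)) with hε
  have hε0 : 0 < ε := lt_min (by linarith) (mul_pos (by linarith) (by positivity))
  have hε1 : ε ≤ z x1 T - v x1 T := min_le_left _ _
  have hε2 : ε ≤ (1-ϑ) * (κ0 * s0^2) := min_le_right _ _
  obtain ⟨R, hR1, hR2⟩ : ∃ R, ‖x1‖ ≤ R ∧ φ R < κ0 :=
    ((eventually_ge_atTop ‖x1‖).and (hφ.lim.eventually_lt_const hκ0)).exists
  have hR0 : 0 ≤ R := (norm_nonneg _).trans hR1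
  have hout : ∀ y : EuclideanSpace ℝ (Fin n), R ≤ ‖y‖ → ∀ t ≥ 0, z y t = 0 := fun y hy t ht => by
    apply hz0
    have := hφ.anti.antitoneOn (mem_Ici.2 hR0) (mem_Ici.2 (norm_nonneg y)) hy
    linarith [hκge t ht]
  have hφc : Continuous (fun y : EuclideanSpace ℝ (Fin n) => φ ‖y‖) :=
    hφ.cont.comp_continuous continuous_norm (fun y => norm_nonneg y)
  have hzc : Continuous (fun q : EuclideanSpace ℝ (Fin n) × ℝ => z q.1 q.2) := by
    simp only [hz]
    refine Continuous.div ?_ (hφc.comp continuous_fst) (fun q => (hφpos q.1).ne')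
    exact (((hφc.comp continuous_fst).sub (hκc.comp continuous_snd)).max continuous_const).pow 2
  obtain ⟨x, hxC, t, ht0, htT, hxt, hle⟩ := first_touch (C := Metric.closedBall (0 : EuclideanSpace ℝ (Fin n)) R)
    (isCompact_closedBall _ _) (h := fun y t => z y t - v y t) (a := 0) (T := T) (ε := ε)
    (hzc.continuousOn.sub (hv.cont.mono (fun q hq => ⟨mem_univ _, hq.2.1⟩)))
    (fun y _ => by
      have := hzle y; have := hge y; have := hv.init y
      linarith)
    ⟨x1, by simpa using hR1, T, ⟨hT, le_rfl⟩, hε1⟩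
  have hle' : ∀ y, ∀ s ∈ Icc 0 t, z y s - v y s ≤ ε := fun y s hs => by
    by_cases hy : ‖y‖ ≤ R
    · exact hle y (by simpa using hy) s hs
    · push Not at hy
      rw [hout y hy.le s hs.1]
      linarith [hv.nonneg y s hs.1]
  have hvn := hv.nonneg x t ht0.le
  have hκq : κ t < φ ‖x‖ := by
    by_contra h
    push Not at h
    rw [hz0 x t h] at hxt
    linarith
  obtain ⟨g, g', d, hj, hd, hg⟩ := phi_jet hφ hn hp x
  set q := φ ‖x‖ with hq
  have hq0 : 0 < q := hφpos x
  set k := κ t with hk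
  have hk0 : 0 < k := hκpos t
  have hj2 : SubJet n (fun y => z y t) x _ _ _ := hj.comp (a := k)
    (J := fun q => q - 2 * k + k^2 / q) (J' := fun q => 1 - k^2/q^2) (J2 := 2 * k^2/q^3) hκq
    (fun w hw => by
      have hw0 : w ≠ 0 := by have : k < w := hw
                             linarith
      refine (((hasDerivAt_id w).sub_const (2*k)).add ((hasDerivAt_inv hw0).const_mul (k^2))).congr_deriv ?_
      field_simp; ring)
    (by
      have hw0 : q ≠ 0 := hq0.ne'
      have h1 := (((hasDerivAt_pow 2 q).inv (by positivity)).const_mul (k^2)).const_sub 1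
      refine h1.congr_deriv ?_
      field_simp; simp; ring)
    (fun a ha b hb hab => by
      have ha' : k < a := ha
      have ha0 : 0 < a := by linarith
      have hb0 : 0 < b := by linarith
      have h1 : k^2 ≤ a * b := by nlinarith
      have h2 : (b - 2 * k + k^2 / b) - (a - 2 * k + k^2 / a) = (b - a) * (a * b - k^2) / (a * b) := by
        field_simp; ring
      have : 0 ≤ (b - a) * (a * b - k^2) / (a * b) := div_nonneg (mul_nonneg (by linarith) (by linarith)) (by positivity)
      simp only; linarith)
    (fun y hy => by
      have h3 := hφpos y
      rw [hz1 y t hy.le]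
      apply le_of_eq
      field_simp; ring)
    (by
      rw [hz1 x t hκq.le, ← hk, ← hq]
      field_simp; ring)
  have hzt : HasDerivAt (z x) (2 * (q - k) * (-(k * K)) / q) t := by
    have hκd : HasDerivAt κ (k * K) t := by
      have := ((((hasDerivAt_id t).const_mul K).exp).const_mul κ0)
      refine this.congr_deriv ?_
      simp only [hk, hκdef, id]; ring
    have h1 := (((hκd.const_sub q).pow 2).div_const q)
    have h2 : z x =ᶠ[nhds t] fun τ => (q - κ τ)^2 / q := by
      filter_upwards [hκc.continuousAt.eventually_lt_const hκq] with τ hτ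
      exact hz1 x τ hτ.le
    refine (h1.congr_of_eventuallyEq h2).congr_deriv ?_
    simp [hk]
  have key := touch hv hp ht0 hj2
    (Eventually.of_forall fun y => by
      rw [hxt]; exact hle' y t ⟨ht0.le, le_rfl⟩)
    (by
      filter_upwards [Ioo_mem_nhdsLT ht0] with τ hτ
      rw [hxt]; exact hle' x τ ⟨hτ.1.le, hτ.2.le⟩)
    hzt
    (by
      filter_upwards [self_mem_nhdsWithin] with τ hτ
      have := hzanti x (le_of_lt hτ)
      linarith)
  rw [Finset.sum_add_distrib, ← Finset.mul_sum, ← Finset.mul_sum, hd] at key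
  have hP : 0 < q^p := by positivity
  have hvp : 0 ≤ v x t ^ p := Real.rpow_nonneg hvn _
  have hvp1 : 0 ≤ v x t ^ (p-1) := Real.rpow_nonneg hvn _
  rcases lt_or_ge (1 - k / q) s0 with hs | hs
  · have hr : 1 < ‖x‖ := by
      by_contra hr
      push Not at hr
      have h1 := hφ.anti.antitoneOn (mem_Ici.2 (norm_nonneg x)) (mem_Ici.2 zero_le_one) hr
      have h2 : k ≤ κ0 * Real.exp (K * T) := hκmono htT
      have h3 : 1/2 < k / q := by linarith
      rw [lt_div_iff₀ hq0] at h3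
      linarith
    have hS := hgr _ hr.le
    rw [← hg (by rintro rfl; simp at hr; linarith)] at hS
    have hA := algA hc hq0 hP hS hk0 hκq hs hs1 hs2
    have : p * v x t ^ (p-1) * (2 * (q - k) * (-(k * K)) / q) ≤ 0 := by
      apply mul_nonpos_of_nonneg_of_nonpos (by positivity)
      apply div_nonpos_of_nonpos_of_nonneg _ hq0.le
      apply mul_nonpos_of_nonneg_of_nonpos (by linarith)
      have : 0 < k * K := by positivity
      linarith
    linarith
  · have hS : 0 ≤ ∑ i, g' i 0 ^ 2 := Finset.sum_nonneg fun i _ => sq_nonneg _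
    have hS2 : 0 ≤ 2 * k^2/q^3 * ∑ i, g' i 0 ^ 2 := mul_nonneg (by positivity) hS
    have hzx : z x t = (q - k)^2 / q := hz1 x t hκq.le
    have hm : κ0 * s0^2 ≤ (q - k)^2 / q := by
      have e : (q - k)^2 / q = q * (1 - k/q)^2 := by field_simp
      rw [e]
      have h1 : κ0 ≤ q := by linarith [hκge t ht0.le]
      gcongr
    have hB := algB (ρ := κ0 / α) (v := v x t) hp hk0 hκq hs0 hs hK hϑ0 hϑ1 hϑp
      (by
        have := phi_le hφ (norm_nonneg x)
        have := hκge t ht0.le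
        gcongr)
      (by
        have : (1-ϑ) * (κ0 * s0^2) ≤ (1-ϑ) * ((q - k)^2 / q) := mul_le_mul_of_nonneg_left hm (by linarith)
        linarith)
    linarith

lemma ge_steady (hφ : IsSteadyState n p α φ) (hn : 2 < n) (hpS : pS n ≤ p) (hα : 0 < α)
    {v : EuclideanSpace ℝ (Fin n) → ℝ → ℝ} {v₀ : EuclideanSpace ℝ (Fin n) → ℝ}
    (hv : IsBddClassicalSol n p v v₀) (hge : ∀ x : EuclideanSpace ℝ (Fin n), φ ‖x‖ ≤ v₀ x)
    (x : EuclideanSpace ℝ (Fin n)) {t : ℝ} (ht : 0 ≤ t) : φ ‖x‖ ≤ v x t := by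
  have hp := p_gt_one hn hpS
  obtain ⟨c, hc, hgr⟩ := grad_lower hφ hn hpS
  set s0 := min (1/2) (c/4) with hs0d
  have hs0 : 0 < s0 := lt_min (by norm_num) (by positivity)
  set K := (2*p+1) / (2 * p * (s0 * (s0^2)^(p-1))) with hKd
  have hK : K * (2 * p * (s0 * (s0^2)^(p-1))) = 2 * p + 1 := by
    rw [hKd]; field_simp
  have hx := hφ.pos _ (norm_nonneg x)
  have hlim : Tendsto (fun κ0 : ℝ => (max (φ ‖x‖ - κ0 * Real.exp (K * t)) 0)^2 / φ ‖x‖)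
      (nhdsWithin 0 (Ioi 0)) (nhds (φ ‖x‖)) := by
    have hcont : Continuous (fun κ0 : ℝ => (max (φ ‖x‖ - κ0 * Real.exp (K * t)) 0)^2 / φ ‖x‖) := by fun_prop
    have := hcont.tendsto 0
    simp only [zero_mul, sub_zero, max_eq_left hx.le] at this
    rw [sq, mul_div_cancel_right₀ _ hx.ne'] at this
    exact this.mono_left nhdsWithin_le_nhds
  refine le_of_tendsto hlim ?_
  have h2 : ∀ᶠ κ0 : ℝ in nhdsWithin 0 (Ioi 0), κ0 * Real.exp (K * t) < φ 1 / 2 := by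
    have hcont : Continuous (fun κ0 : ℝ => κ0 * Real.exp (K * t)) := by fun_prop
    apply Eventually.filter_mono nhdsWithin_le_nhds
    apply hcont.continuousAt.eventually_lt_const
    have := hφ.pos 1 zero_le_one
    simp; exact this
  filter_upwards [self_mem_nhdsWithin, h2] with κ0 h0 h1
  exact core1 hφ hn hp hα hv hge hc hgr hs0 (min_le_left _ _) (min_le_right _ _) hK h0 ht h1 x

end F
end Inst

namespace Inst
section G
variable {n : ℕ} {p α : ℝ} {φ : ℝ → ℝ}

lemma algC {q0 q s N B w c1 C1 K D : ℝ} (hq0 : 0 < q0) (hq : q0 ≤ q) (hs : 0 < s) (hB : 0 ≤ B)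
    (hc1 : 0 < c1) (hw1 : c1 ≤ w) (hw2 : w ≤ C1) (hD : D = 2 * B * C1 + 8 + 4 * N)
    (hK : K * (32 * q0 * c1) = D^2 + 1) (h : 8 * (q - s) - 4 * N * s ≤ w * (2 * B * s - K * s^2)) : False := by
  have hKp : 0 < K := by
    by_contra hcon
    push Not at hcon
    have : 0 < 32 * q0 * c1 := by positivity
    nlinarith [sq_nonneg D]
  have h1 : c1 * (K * s^2) ≤ w * (K * s^2) := by gcongr
  have h2 : w * (2 * B * s) ≤ C1 * (2 * B * s) := by gcongr
  have h3 : 8 * q0 + c1 * K * s^2 - D * s ≤ 0 := by rw [hD]; nlinarith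
  have h4 : 4 * (c1 * K) * (8 * q0 + c1 * K * s^2 - D * s) ≤ 0 :=
    mul_nonpos_of_nonneg_of_nonpos (by positivity) h3
  nlinarith [sq_nonneg (2 * c1 * K * s - D)]

set_option maxHeartbeats 1000000 in
lemma strict_at_one (hφ : IsSteadyState n p α φ) (hn : 2 < n) (hp : 1 < p)
    {v : EuclideanSpace ℝ (Fin n) → ℝ → ℝ} {v₀ : EuclideanSpace ℝ (Fin n) → ℝ}
    (hv : IsBddClassicalSol n p v v₀) (hcont : Continuous v₀)
    (hge : ∀ x : EuclideanSpace ℝ (Fin n), ∀ t ≥ 0, φ ‖x‖ ≤ v x t)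
    (hne : ∃ x : EuclideanSpace ℝ (Fin n), v₀ x ≠ φ ‖x‖) (r0 : ℝ) (hr0 : 0 < r0) :
    ∃ γ > 0, ∀ x : EuclideanSpace ℝ (Fin n), ‖x‖ ≤ r0 → φ ‖x‖ + γ ≤ v x 1 := by
  obtain ⟨x1, hx1⟩ := hne
  have hφc : Continuous (fun y : EuclideanSpace ℝ (Fin n) => φ ‖y‖) :=
    hφ.cont.comp_continuous continuous_norm (fun y => norm_nonneg y)
  have hgt : φ ‖x1‖ < v₀ x1 := by
    have := hge x1 0 le_rfl
    rw [hv.init] at this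
    exact lt_of_le_of_ne this (Ne.symm hx1)
  obtain ⟨γ, hγ⟩ : ∃ γ, γ = (v₀ x1 - φ ‖x1‖) / 2 := ⟨_, rfl⟩
  have hγ0 : 0 < γ := by rw [hγ]; linarith
  obtain ⟨δ, hδ, hball⟩ : ∃ δ > 0, ∀ y, ‖y - x1‖ ≤ δ → φ ‖y‖ + γ ≤ v₀ y := by
    have h1 : ∀ᶠ y in nhds x1, γ < v₀ y - φ ‖y‖ :=
      (hcont.sub hφc).continuousAt.eventually_const_lt (by
        change γ < v₀ x1 - φ ‖x1‖
        rw [hγ]; linarith)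
    obtain ⟨δ, hδ, h⟩ := Metric.eventually_nhds_iff_ball.1 h1
    refine ⟨δ/2, by positivity, fun y hy => ?_⟩
    have := h y (by rw [Metric.mem_ball, dist_eq_norm]; linarith)
    linarith
  obtain ⟨q0, hq0d⟩ : ∃ q0, q0 = δ^2 := ⟨_, rfl⟩
  have hq0 : 0 < q0 := by rw [hq0d]; positivity
  obtain ⟨B, hBd⟩ : ∃ B, B = (‖x1‖ + r0)^2 + 1 := ⟨_, rfl⟩
  have hB : 0 < B := by rw [hBd]; positivity
  obtain ⟨R1, hR1d⟩ : ∃ R1, R1 = q0 + B + 1 := ⟨_, rfl⟩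
  have hR1 : 0 < R1 := by rw [hR1d]; positivity
  have hR1s : q0 + B ≤ R1^2 := by rw [hR1d]; nlinarith
  obtain ⟨M, hM⟩ := hv.bdd 1 one_pos
  obtain ⟨R2, hR2d⟩ : ∃ R2, R2 = ‖x1‖ + R1 := ⟨_, rfl⟩
  have hR2 : 0 ≤ R2 := by rw [hR2d]; positivity
  have hφR := hφ.pos R2 hR2
  obtain ⟨c1, hc1d⟩ : ∃ c1, c1 = p * φ R2 ^ (p-1) := ⟨_, rfl⟩
  have hc1 : 0 < c1 := by rw [hc1d]; positivity
  obtain ⟨C1, hC1d⟩ : ∃ C1, C1 = p * M ^ (p-1) := ⟨_, rfl⟩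
  obtain ⟨D, hD⟩ : ∃ D, D = 2 * B * C1 + 8 + 4 * (n:ℝ) := ⟨_, rfl⟩
  obtain ⟨K, hKd⟩ : ∃ K, K = (D^2 + 1) / (32 * q0 * c1) := ⟨_, rfl⟩
  have hK : K * (32 * q0 * c1) = D^2 + 1 := by rw [hKd]; field_simp
  obtain ⟨e0, he0d⟩ : ∃ e0, e0 = γ / q0^2 := ⟨_, rfl⟩
  have he0 : 0 < e0 := by rw [he0d]; positivity
  set S : EuclideanSpace ℝ (Fin n) → ℝ → ℝ := fun y t => q0 + B * t - ‖y - x1‖^2 with hS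
  set η : EuclideanSpace ℝ (Fin n) → ℝ → ℝ := fun y t => e0 * Real.exp (-(K * t)) * (max (S y t) 0)^2 with hη
  have hη0 : ∀ y t, S y t ≤ 0 → η y t = 0 := fun y t h => by
    simp only [hη]; rw [max_eq_right h]; simp
  have hη1 : ∀ y t, 0 ≤ S y t → η y t = e0 * Real.exp (-(K * t)) * (S y t)^2 := fun y t h => by
    simp only [hη]; rw [max_eq_left h]
  have hSc : Continuous (fun q : EuclideanSpace ℝ (Fin n) × ℝ => S q.1 q.2) := by
    simp only [hS]; fun_prop
  have hηc : Continuous (fun q : EuclideanSpace ℝ (Fin n) × ℝ => η q.1 q.2) := by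
    simp only [hη]
    exact (by fun_prop : Continuous fun q : EuclideanSpace ℝ (Fin n) × ℝ => e0 * Real.exp (-(K * q.2))).mul
      ((hSc.max continuous_const).pow 2)
  have hout : ∀ y, R1 ≤ ‖y - x1‖ → ∀ t ≤ 1, η y t = 0 := fun y hy t ht => by
    apply hη0
    simp only [hS]
    have h1 : R1^2 ≤ ‖y - x1‖^2 := by gcongr
    nlinarith
  have hinit : ∀ y, φ ‖y‖ + η y 0 ≤ v y 0 := fun y => by
    rcases le_total (S y 0) 0 with h | h
    · rw [hη0 y 0 h]; linarith [hge y 0 le_rfl]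
    · rw [hη1 y 0 h, hv.init]
      simp only [hS, mul_zero, add_zero] at h ⊢
      have h1 : ‖y - x1‖ ≤ δ := by
        rw [hq0d] at h
        exact le_of_sq_le_sq (by linarith) hδ.le
      have h2 := hball y h1
      have h3 : (q0 - ‖y-x1‖^2)^2 ≤ q0^2 := by
        have := sq_nonneg ‖y-x1‖
        gcongr; linarith
      have h4 : e0 * q0^2 = γ := by rw [he0d]; field_simp
      have h5 : e0 * (q0 - ‖y-x1‖^2)^2 ≤ e0 * q0^2 := by gcongr
      simp only [neg_zero, Real.exp_zero, mul_one]
      linarith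
  have main : ∀ y, φ ‖y‖ + η y 1 ≤ v y 1 := by
    intro x2
    by_contra hcon
    push Not at hcon
    obtain ⟨ε, hε⟩ : ∃ ε, ε = φ ‖x2‖ + η x2 1 - v x2 1 := ⟨_, rfl⟩
    have hε0 : 0 < ε := by rw [hε]; linarith
    have hx2 : ‖x2 - x1‖ ≤ R1 := by
      by_contra h
      push Not at h
      rw [hout x2 h.le 1 le_rfl] at hcon
      linarith [hge x2 1 zero_le_one]
    obtain ⟨x, hxC, t, ht0, htT, hxt, hle⟩ := first_touch (C := Metric.closedBall x1 R1)
      (isCompact_closedBall _ _) (h := fun y t => φ ‖y‖ + η y t - v y t) (a := 0) (T := 1) (ε := ε)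
      (((hφc.comp continuous_fst).add hηc).continuousOn.sub (hv.cont.mono (fun q hq => ⟨mem_univ _, hq.2.1⟩)))
      (fun y _ => by have := hinit y; linarith)
      ⟨x2, by rw [Metric.mem_closedBall, dist_eq_norm]; exact hx2, 1, ⟨zero_le_one, le_rfl⟩, hε.le⟩
    have hle' : ∀ y, ∀ s ∈ Icc 0 t, φ ‖y‖ + η y s - v y s ≤ ε := fun y s hs => by
      by_cases hy : ‖y - x1‖ ≤ R1
      · exact hle y (by rw [Metric.mem_closedBall, dist_eq_norm]; exact hy) s hs
      · push Not at hy
        rw [hout y hy.le s (hs.2.trans htT)]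
        linarith [hge y s hs.1]
    have hvx := hge x t ht0.le
    have hφx := hφ.pos _ (norm_nonneg x)
    have hSp : 0 < S x t := by
      by_contra h
      push Not at h
      rw [hη0 x t h] at hxt
      linarith
    obtain ⟨g, g', d, hj, hd, -⟩ := phi_jet hφ hn hp x
    set E := e0 * Real.exp (-(K * t)) with hE
    have hE0 : 0 < E := by rw [hE]; positivity
    set s := S x t with hs
    set y : EuclideanSpace ℝ (Fin n) := x - x1 with hy
    have hAc : ∀ i, ∀ τ : ℝ, S (x + τ • EuclideanSpace.single i (1:ℝ)) t = s - 2 * τ * y i - τ^2 := fun i τ => by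
      simp only [hs, hS]
      rw [show x + τ • EuclideanSpace.single i (1:ℝ) - x1 = y + τ • EuclideanSpace.single i (1:ℝ) by rw [hy]; abel, norm_line_sq]
      ring
    have hj2 : SubJet n (fun y => φ ‖y‖ + η y t) x
        (fun i τ => g i τ + E * (s - 2 * τ * y i - τ^2)^2)
        (fun i τ => g' i τ + E * (2 * (s - 2 * τ * y i - τ^2) * (-(2 * y i) - 2 * τ)))
        (fun i => d i + E * (8 * y i ^ 2 - 4 * s)) := by
      have hA : ∀ i, ∀ τ : ℝ, HasDerivAt (fun τ : ℝ => s - 2 * τ * y i - τ^2) (-(2 * y i) - 2 * τ) τ := fun i τ => by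
        refine ((((hasDerivAt_id τ).const_mul 2).mul_const (y i)).const_sub s |>.sub (hasDerivAt_pow 2 τ)).congr_deriv ?_
        simp
      refine ⟨fun i => ?_, fun i => ?_, fun i => ?_, fun i => ?_⟩
      · filter_upwards [hj.h1 i] with τ hτ
        refine (hτ.add (((hA i τ).pow 2).const_mul E)).congr_deriv ?_
        simp
      · have hA2 : HasDerivAt (fun τ : ℝ => -(2 * y i) - 2 * τ) (-2) 0 := by
          refine (((hasDerivAt_id (0:ℝ)).const_mul 2).const_sub (-(2 * y i))).congr_deriv ?_
          simp
        refine ((hj.h2 i).add ((((hA i 0).const_mul 2).mul hA2).const_mul E)).congr_deriv ?_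
        simp
        left; ring
      · simp only [hj.h0]
        rw [hη1 x t hSp.le]
        simp
        rfl
      · have hcA : ∀ᶠ τ in nhds (0:ℝ), 0 < s - 2 * τ * y i - τ^2 := by
          apply (hA i 0).continuousAt.eventually_const_lt
          simpa using hSp
        filter_upwards [hj.le i, hcA] with τ h1 h2
        rw [← hAc] at h2
        rw [hη1 _ t h2.le, hAc]
        linarith
    have hzt : HasDerivAt (fun τ => φ ‖x‖ + η x τ) (E * (2 * B * s - K * s^2)) t := by
      have h1 : HasDerivAt (fun τ => S x τ) B t := by
        simp only [hS]
        refine ((((hasDerivAt_id t).const_mul B).const_add q0).sub_const _).congr_deriv ?_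
        simp
      have h2 : HasDerivAt (fun τ => e0 * Real.exp (-(K * τ))) (-(K * E)) t := by
        refine ((((hasDerivAt_id t).const_mul K).neg.exp).const_mul e0).congr_deriv ?_
        simp only [hE, id]
        ring_nf
        simp
      have h3 := (h2.mul (h1.pow 2)).const_add (φ ‖x‖)
      have h4 : (fun τ => φ ‖x‖ + η x τ) =ᶠ[nhds t] fun τ => φ ‖x‖ + e0 * Real.exp (-(K * τ)) * (S x τ)^2 := by
        filter_upwards [h1.continuousAt.eventually_const_lt hSp] with τ hτ
        rw [hη1 x τ hτ.le]
      refine (HasDerivAt.congr_of_eventuallyEq h3 h4).congr_deriv ?_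
      simp
      ring
    have key := touch (Z := fun y t => φ ‖y‖ + η y t) hv hp ht0 hj2
      (Eventually.of_forall fun y => by
        rw [hxt]; exact hle' y t ⟨ht0.le, le_rfl⟩)
      (by
        filter_upwards [Ioo_mem_nhdsLT ht0] with τ hτ
        rw [hxt]; exact hle' x τ ⟨hτ.1.le, hτ.2.le⟩)
      hzt
      (by
        have h1 : ∀ᶠ τ in nhds t, φ ‖x‖ + η x t - v x t < φ ‖x‖ + η x τ :=
          hzt.continuousAt.eventually_const_lt (by linarith)
        filter_upwards [h1.filter_mono nhdsWithin_le_nhds] with τ hτ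
        linarith)
    rw [Finset.sum_add_distrib, ← Finset.mul_sum, hd, Finset.sum_sub_distrib, ← Finset.mul_sum] at key
    have hsum : ∑ i, y i ^ 2 = ‖y‖^2 := by
      rw [EuclideanSpace.norm_sq_eq]; simp
    have hsy : ‖y‖^2 = q0 + B * t - s := by simp only [hs, hS, hy]; ring
    rw [hsum, hsy] at key
    simp only [Finset.sum_const, Finset.card_univ, Fintype.card_fin, nsmul_eq_mul] at key
    have hvp : φ ‖x‖ ^ p ≤ v x t ^ p := Real.rpow_le_rpow hφx.le hvx (by linarith)
    have hxR : ‖x‖ ≤ R2 := by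
      rw [Metric.mem_closedBall, dist_eq_norm] at hxC
      have := norm_le_norm_add_norm_sub' x x1
      rw [hR2d]; linarith
    have hw1 : c1 ≤ p * v x t ^ (p-1) := by
      rw [hc1d]
      have := hφ.anti.antitoneOn (mem_Ici.2 (norm_nonneg x)) (mem_Ici.2 hR2) hxR
      have := Real.rpow_le_rpow hφR.le (this.trans hvx) (by linarith : 0 ≤ p - 1)
      gcongr
    have hw2 : p * v x t ^ (p-1) ≤ C1 := by
      rw [hC1d]
      have := Real.rpow_le_rpow (hφx.le.trans hvx) (hM x t ⟨ht0.le, htT⟩) (by linarith : 0 ≤ p - 1)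
      gcongr
    refine algC (N := n) (q := q0 + B * t) hq0 (by linarith [mul_pos hB ht0]) hSp hB.le hc1 hw1 hw2 hD hK ?_
    have h9 : E * (8 * (q0 + B * t - s) - 4 * n * s) ≤ E * (p * v x t ^ (p-1) * (2 * B * s - K * s^2)) := by
      linarith
    exact le_of_mul_le_mul_left h9 hE0
  refine ⟨e0 * Real.exp (-K), by positivity, fun x hx => ?_⟩
  have h1 : 1 ≤ S x 1 := by
    simp only [hS]
    have h2 : ‖x - x1‖ ≤ ‖x1‖ + r0 := (norm_sub_le x x1).trans (by linarith)
    have h3 : ‖x - x1‖^2 ≤ (‖x1‖ + r0)^2 := by gcongr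
    rw [hBd]; linarith
  have h2 := main x
  rw [hη1 x 1 (by linarith), mul_one] at h2
  have h3 : 1 ≤ (S x 1)^2 := by nlinarith
  have h4 : 0 < e0 * Real.exp (-K) := by positivity
  nlinarith

end G
end Inst

namespace Inst
section H
variable {n : ℕ} {p α : ℝ} {φ : ℝ → ℝ}

lemma jet_scale {F : EuclideanSpace ℝ (Fin n) → ℝ} {x : EuclideanSpace ℝ (Fin n)} {g g' : Fin n → ℝ → ℝ}
    {d : Fin n → ℝ} {μ A : ℝ} (hA : 0 ≤ A) (h : SubJet n F (μ • x) g g' d) :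
    SubJet n (fun y => A * F (μ • y)) x (fun i s => A * g i (μ * s)) (fun i s => A * μ * g' i (μ * s))
      (fun i => A * μ ^ 2 * d i) := by
  have hm : ∀ s : ℝ, HasDerivAt (fun s : ℝ => μ * s) μ s := fun s => by
    simpa using (hasDerivAt_id s).const_mul μ
  have ht : Tendsto (fun s : ℝ => μ * s) (nhds 0) (nhds 0) := by
    have := (hm 0).continuousAt.tendsto
    simpa using this
  refine ⟨fun i => ?_, fun i => ?_, fun i => ?_, fun i => ?_⟩
  · filter_upwards [ht.eventually (h.h1 i)] with s hs
    refine ((hs.comp s (hm s)).const_mul A).congr_deriv ?_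
    ring
  · have h2 : HasDerivAt (g' i) (d i) (μ * 0) := by rw [mul_zero]; exact h.h2 i
    refine ((h2.comp 0 (hm 0)).const_mul (A * μ)).congr_deriv ?_
    ring
  · simp only [mul_zero, h.h0]
  · filter_upwards [ht.eventually (h.le i)] with s hs
    rw [smul_add, smul_smul]
    gcongr

lemma choose_lambda (hφ : IsSteadyState n p α φ) {r0 μ0 μ1 ν γ : ℝ} (hr0 : 0 < r0) (hμ0 : 1 < μ0) (hμ : μ0 ≤ μ1)
    (h : ∀ μ > 1, μ ^ ν * φ (μ * r0) < φ r0) (h0 : (μ0^ν - 1) * α < γ) :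
    ∃ l > 1, (∀ μ ∈ Icc μ0 μ1, l * μ ^ ν * φ (μ * r0) < φ r0) ∧ (l * μ0^ν - 1) * α < γ := by
  have hc : ContinuousOn (fun μ : ℝ => μ ^ ν * φ (μ * r0)) (Icc μ0 μ1) := by
    apply ContinuousOn.mul
    · intro μ hm
      exact (Real.continuousAt_rpow_const μ ν (Or.inl (by linarith [hm.1]))).continuousWithinAt
    · exact hφ.cont.comp (by fun_prop) (fun μ hm => mem_Ici.2 (mul_nonneg (by linarith [hm.1]) hr0.le))
  obtain ⟨m, hm, hmax⟩ := isCompact_Icc.exists_isMaxOn ⟨μ0, le_rfl, hμ⟩ hc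
  have hlt := h m (by linarith [hm.1])
  have e1 : ∀ᶠ l in nhdsWithin (1:ℝ) (Ioi 1), l * (m ^ ν * φ (m * r0)) < φ r0 := by
    apply Eventually.filter_mono nhdsWithin_le_nhds
    apply (by fun_prop : Continuous fun l : ℝ => l * (m ^ ν * φ (m * r0))).continuousAt.eventually_lt_const
    simpa using hlt
  have e2 : ∀ᶠ l in nhdsWithin (1:ℝ) (Ioi 1), (l * μ0^ν - 1) * α < γ := by
    apply Eventually.filter_mono nhdsWithin_le_nhds
    apply (by fun_prop : Continuous fun l : ℝ => (l * μ0^ν - 1) * α).continuousAt.eventually_lt_const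
    simpa using h0
  have e3 : ∀ᶠ l in nhdsWithin (1:ℝ) (Ioi 1), 1 < l := self_mem_nhdsWithin
  obtain ⟨l, h1, h2, h3⟩ := (e1.and (e2.and e3)).exists
  refine ⟨l, h3, fun μ hμ => ?_, h2⟩
  have : μ ^ ν * φ (μ * r0) ≤ m ^ ν * φ (m * r0) := hmax hμ
  calc l * μ ^ ν * φ (μ * r0) = l * (μ ^ ν * φ (μ * r0)) := by ring
    _ ≤ l * (m ^ ν * φ (m * r0)) := by gcongr
    _ < _ := h1

set_option maxHeartbeats 1000000 in
lemma growth_core (hφ : IsSteadyState n p α φ) (hn : 2 < n) (hp : 1 < p) (hα : 0 < α)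
    {v : EuclideanSpace ℝ (Fin n) → ℝ → ℝ} {v₀ : EuclideanSpace ℝ (Fin n) → ℝ}
    (hv : IsBddClassicalSol n p v v₀)
    (hge : ∀ x : EuclideanSpace ℝ (Fin n), ∀ t ≥ 0, φ ‖x‖ ≤ v x t) {r0 γ : ℝ} (hr0 : 0 < r0)
    (hst : ∀ x : EuclideanSpace ℝ (Fin n), ‖x‖ ≤ r0 → φ ‖x‖ + γ ≤ v x 1)
    {ν l μ0 μ1 σ T : ℝ} (hν : 0 < ν) (hνp : ν * p = ν + 2) (hl : 1 < l) (hμ0 : 1 < μ0)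
    (hb : ∀ μ ∈ Icc μ0 μ1, l * μ ^ ν * φ (μ * r0) < φ r0) (hi : (l * μ0^ν - 1) * α < γ)
    (hσ : 0 ≤ σ) (hT : 1 ≤ T) (hend : μ0 * Real.exp (σ * (T - 1)) = μ1)
    (hsmall : p * ν * σ * l^p < l^p - l) : l * μ1^ν * α ≤ v 0 T := by
  set μ : ℝ → ℝ := fun t => μ0 * Real.exp (σ * (t - 1)) with hμd
  have hμpos : ∀ t, 0 < μ t := fun t => by simp only [hμd]; positivity
  have hμc : Continuous μ := by simp only [hμd]; fun_prop
  have hμI : ∀ t ∈ Icc 1 T, μ t ∈ Icc μ0 μ1 := fun t ht => by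
    constructor
    · have : 1 ≤ Real.exp (σ * (t-1)) := Real.one_le_exp (mul_nonneg hσ (by linarith [ht.1]))
      simp only [hμd]; nlinarith
    · rw [← hend]; simp only [hμd]
      have := ht.2
      gcongr
  have hμ1 : μ 1 = μ0 := by simp [hμd]
  have hμT : μ T = μ1 := hend
  set ψ : EuclideanSpace ℝ (Fin n) → ℝ → ℝ := fun y t => l * μ t ^ ν * φ (‖μ t • y‖) with hψ
  have hnorm : ∀ (y : EuclideanSpace ℝ (Fin n)) t, ‖μ t • y‖ = μ t * ‖y‖ := fun y t => by
    rw [norm_smul, Real.norm_of_nonneg (hμpos t).le]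
  have hφc : Continuous (fun y : EuclideanSpace ℝ (Fin n) => φ ‖y‖) :=
    hφ.cont.comp_continuous continuous_norm (fun y => norm_nonneg y)
  have hμνc : Continuous (fun t => μ t ^ ν) :=
    hμc.rpow_const (fun t => Or.inl (hμpos t).ne')
  have hψc : Continuous (fun q : EuclideanSpace ℝ (Fin n) × ℝ => ψ q.1 q.2) := by
    simp only [hψ]
    exact (continuous_const.mul (hμνc.comp continuous_snd)).mul
      (hφc.comp ((hμc.comp continuous_snd).smul continuous_fst))
  have hψpos : ∀ y t, 0 < ψ y t := fun y t => by
    have := hμpos t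
    have := hφ.pos _ (norm_nonneg (μ t • y))
    simp only [hψ]; positivity
  have h0T : ψ 0 T = l * μ1^ν * α := by simp [hψ, hμT, hφ.val0]
  rw [← h0T]
  by_contra hcon
  push Not at hcon
  obtain ⟨x, hxC, t, ht0, htT, hxt, hle⟩ := first_touch (C := Metric.closedBall (0 : EuclideanSpace ℝ (Fin n)) r0)
    (isCompact_closedBall _ _) (h := fun y t => ψ y t - v y t) (a := 1) (T := T) (ε := 0)
    (hψc.continuousOn.sub (hv.cont.mono (fun q hq => ⟨mem_univ _, zero_le_one.trans hq.2.1⟩)))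
    (fun y hy => by
      have hy' : ‖y‖ ≤ r0 := by simpa using hy
      have h1 := hst y hy'
      have h2 : φ (μ0 * ‖y‖) ≤ φ ‖y‖ := hφ.anti.antitoneOn (mem_Ici.2 (norm_nonneg y))
        (mem_Ici.2 (mul_nonneg (by linarith) (norm_nonneg y))) (by nlinarith [norm_nonneg y])
      have h3 := phi_le hφ (norm_nonneg y)
      have h4 : ψ y 1 = l * μ0^ν * φ (μ0 * ‖y‖) := by
        simp only [hψ]; rw [hnorm, hμ1]
      have h5 : 1 ≤ μ0 ^ ν := Real.one_le_rpow hμ0.le hν.le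
      have h6 : 1 ≤ l * μ0^ν := by nlinarith
      have h7 : l * μ0^ν * φ (μ0 * ‖y‖) ≤ l * μ0^ν * φ ‖y‖ := by gcongr
      have h8 : (l * μ0^ν - 1) * φ ‖y‖ ≤ (l * μ0^ν - 1) * α := by gcongr
      rw [h4]
      linarith)
    ⟨0, by simp [hr0.le], T, ⟨hT, le_rfl⟩, by linarith⟩
  have htp : 0 < t := by linarith
  have hvψ : v x t = ψ x t := by linarith
  have hxr : ‖x‖ < r0 := by
    have h1 : ‖x‖ ≤ r0 := by simpa using hxC
    refine lt_of_le_of_ne h1 fun he => ?_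
    have h2 := hb (μ t) (hμI t ⟨ht0.le, htT⟩)
    have h3 := hge x t htp.le
    rw [hvψ, he] at h3
    simp only [hψ] at h3
    rw [hnorm, he] at h3
    linarith
  obtain ⟨g, g', d, hj, hd, -⟩ := phi_jet hφ hn hp (μ t • x)
  have hA : 0 < l * μ t ^ ν := by have := hμpos t; positivity
  have hj2 := jet_scale hA.le hj
  obtain ⟨zt, hzt, hztle⟩ : ∃ zt, HasDerivAt (ψ x) zt t ∧ zt ≤ ν * σ * ψ x t := by
    have hμd' : HasDerivAt μ (μ t * σ) t := by
      refine (((((hasDerivAt_id t).sub_const 1).const_mul σ).exp).const_mul μ0).congr_deriv ?_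
      simp only [hμd, id]; ring
    have h1 : HasDerivAt (fun t => l * μ t ^ ν) (l * μ t ^ ν * (ν * σ)) t := by
      refine ((hμd'.rpow_const (p := ν) (Or.inl (hμpos t).ne')).const_mul l).congr_deriv ?_
      rw [Real.rpow_sub_one (hμpos t).ne']
      have := (hμpos t).ne'
      field_simp
    have he : ψ x = fun t => l * μ t ^ ν * φ (μ t * ‖x‖) := by
      funext t; simp only [hψ]; rw [hnorm]
    rw [he]
    by_cases hx0 : ‖x‖ = 0
    · refine ⟨l * μ t ^ ν * (ν * σ) * φ 0, ?_, ?_⟩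
      · simp only [hx0, mul_zero]
        exact h1.mul_const _
      · simp only [hx0, mul_zero]
        apply le_of_eq; ring
    · have hxp : 0 < ‖x‖ := lt_of_le_of_ne (norm_nonneg x) (Ne.symm hx0)
      have hmx : 0 < μ t * ‖x‖ := mul_pos (hμpos t) hxp
      have h2 := (hd1 hφ hmx).comp t (hμd'.mul_const ‖x‖)
      refine ⟨_, h1.mul h2, ?_⟩
      simp only [Function.comp]
      have h3 := d1_nonpos hφ hmx
      have h4 : l * μ t ^ ν * (deriv φ (μ t * ‖x‖) * (μ t * σ * ‖x‖)) ≤ 0 := by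
        apply mul_nonpos_of_nonneg_of_nonpos hA.le
        apply mul_nonpos_of_nonpos_of_nonneg h3
        have := hμpos t
        positivity
      linarith
  have key := touch (Z := ψ) hv hp htp hj2
    (by
      have : Metric.closedBall (0 : EuclideanSpace ℝ (Fin n)) r0 ∈ nhds x := by
        apply Filter.mem_of_superset (Metric.isOpen_ball.mem_nhds _) Metric.ball_subset_closedBall
        simpa using hxr
      filter_upwards [this] with y hy
      rw [hxt]; exact hle y hy t ⟨ht0.le, le_rfl⟩)
    (by
      filter_upwards [Ioo_mem_nhdsLT ht0] with τ hτ
      rw [hxt]; exact hle x hxC τ ⟨hτ.1.le, hτ.2.le⟩)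
    hzt
    (Eventually.of_forall fun τ => by
      have := hψpos x τ
      linarith)
  rw [← Finset.mul_sum, hd, hvψ] at key
  set P := φ ‖μ t • x‖ with hP
  have hP0 : 0 < P := hφ.pos _ (norm_nonneg _)
  have hm0 := hμpos t
  have e1 : ψ x t ^ p = l^p * (μ t ^ ν * μ t ^ 2 * P^p) := by
    change (l * μ t ^ ν * P)^p = _
    rw [Real.mul_rpow hA.le hP0.le, Real.mul_rpow (by linarith) (by positivity), ← Real.rpow_mul hm0.le, hνp,
      Real.rpow_add hm0, Real.rpow_two]
    ring
  have e2 : p * ψ x t ^ (p-1) * zt ≤ p * ν * σ * ψ x t ^ p := by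
    rw [pw_split (p := p) (hψpos x t)]
    have : 0 < ψ x t ^ (p-1) := Real.rpow_pos_of_pos (hψpos x t) _
    calc p * ψ x t ^ (p-1) * zt ≤ p * ψ x t ^ (p-1) * (ν * σ * ψ x t) := by gcongr
      _ = _ := by ring
  rw [e1] at key e2
  have hQ : 0 < μ t ^ ν * μ t ^ 2 * P^p := by positivity
  have h9 : (l^p - l) * (μ t ^ ν * μ t ^ 2 * P^p) ≤ (p * ν * σ * l^p) * (μ t ^ ν * μ t ^ 2 * P^p) := by
    linarith
  have := le_of_mul_le_mul_right h9 hQ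
  linarith

lemma growth (hφ : IsSteadyState n p α φ) (hn : 2 < n) (hpS : pS n ≤ p) (hpc : n ≤ 10 ∨ p < pc n) (hα : 0 < α)
    {v : EuclideanSpace ℝ (Fin n) → ℝ → ℝ} {v₀ : EuclideanSpace ℝ (Fin n) → ℝ} (hcont : Continuous v₀)
    (hv : IsBddClassicalSol n p v v₀) (hge0 : ∀ x : EuclideanSpace ℝ (Fin n), φ ‖x‖ ≤ v₀ x)
    (hne : ∃ x : EuclideanSpace ℝ (Fin n), v₀ x ≠ φ ‖x‖) (b : ℝ) : ∃ t1 > 0, ∀ T ≥ t1, b ≤ v 0 T := by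
  have hp := p_gt_one hn hpS
  have hge : ∀ x : EuclideanSpace ℝ (Fin n), ∀ t ≥ 0, φ ‖x‖ ≤ v x t := fun x t ht =>
    ge_steady hφ hn hpS hα hv hge0 x ht
  obtain ⟨r0, hr0, hpk⟩ := exists_r0 hφ hn hpS hpc
  obtain ⟨γ, hγ, hst⟩ := strict_at_one hφ hn hp hv hcont hge hne r0 hr0
  obtain ⟨ν, hνd⟩ : ∃ ν, ν = 2 / (p-1) := ⟨_, rfl⟩
  rw [← hνd] at hpk
  have hp1 : 0 < p - 1 := by linarith
  have hν : 0 < ν := by rw [hνd]; positivity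
  have hνp : ν * p = ν + 2 := by rw [hνd]; field_simp; ring
  obtain ⟨μ0, hμ0, hμγ⟩ : ∃ μ0 > 1, (μ0^ν - 1) * α < γ := by
    have e1 : ∀ᶠ m in nhdsWithin (1:ℝ) (Ioi 1), (m^ν - 1) * α < γ := by
      apply Eventually.filter_mono nhdsWithin_le_nhds
      have : ContinuousAt (fun m : ℝ => (m^ν - 1) * α) 1 :=
        ((Real.continuousAt_rpow_const 1 ν (Or.inr hν.le)).sub continuousAt_const).mul continuousAt_const
      apply this.eventually_lt_const
      simpa using hγ
    have e3 : ∀ᶠ l in nhdsWithin (1:ℝ) (Ioi 1), 1 < l := self_mem_nhdsWithin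
    obtain ⟨m, h1, h2⟩ := (e1.and e3).exists
    exact ⟨m, h2, h1⟩
  obtain ⟨μ1, hμ1, hbμ⟩ : ∃ μ1, μ0 ≤ μ1 ∧ b ≤ μ1 ^ ν * α := by
    have : Tendsto (fun m : ℝ => m ^ ν * α) atTop atTop := (tendsto_rpow_atTop hν).atTop_mul_const hα
    exact ((eventually_ge_atTop μ0).and (this.eventually_ge_atTop b)).exists
  obtain ⟨l, hl, hlb, hli⟩ := choose_lambda hφ hr0 hμ0 hμ1 hpk hμγ
  have hlp : 0 < l^p - l := by
    have := Real.rpow_lt_rpow_of_exponent_lt hl hp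
    rw [Real.rpow_one] at this
    linarith
  have hl0 : 0 < l := by linarith
  have hlg : 0 ≤ Real.log (μ1 / μ0) := Real.log_nonneg ((one_le_div (by linarith)).2 hμ1)
  set G := p * ν * l^p * Real.log (μ1 / μ0) / (l^p - l) with hG
  have hG0 : 0 ≤ G := by rw [hG]; positivity
  refine ⟨G + 2, by linarith, fun T hT => ?_⟩
  have hT1 : 0 < T - 1 := by linarith
  have h := growth_core hφ hn hp hα hv hge hr0 hst (σ := Real.log (μ1/μ0) / (T-1)) (T := T) hν hνp hl hμ0 hlb hli
    (by positivity) (by linarith)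
    (by
      rw [div_mul_cancel₀ _ hT1.ne', Real.exp_log (div_pos (by linarith) (by linarith))]
      field_simp)
    (by
      have h1 : G < T - 1 := by linarith
      rw [hG, div_lt_iff₀ hlp] at h1
      rw [← mul_div_assoc, div_mul_eq_mul_div, div_lt_iff₀ hT1]
      linarith)
  have h2 : 0 < μ1 ^ ν * α := by
    have : 0 < μ1 := by linarith
    positivity
  nlinarith

end H
end Inst
/-- Proposition 1.3(i): let `n > 2`, `p_S ≤ p < p_c` (with `p_c = ∞` if
`n ≤ 10`) and `α > 0`. If `v₀` is bounded and continuous with `v₀ ≥ φ_α(|·|)` and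
`v₀ ≢ φ_α(|·|)`, then every bounded classical solution `v` with initial data `v₀`
satisfies `‖v(·,t)‖_{L^∞(ℝⁿ)} → ∞` as `t → ∞`. -/
theorem instability_from_above (n : ℕ) (hn : 2 < n) (p α : ℝ)
    (hpS : pS n ≤ p) (hpc : n ≤ 10 ∨ p < pc n) (hα : 0 < α)
    (φ : ℝ → ℝ) (hφ : IsSteadyState n p α φ)
    (v₀ : EuclideanSpace ℝ (Fin n) → ℝ) (hv₀cont : Continuous v₀)
    (hv₀bdd : ∃ M, ∀ x, v₀ x ≤ M)
    (hv₀ge : ∀ x : EuclideanSpace ℝ (Fin n), φ ‖x‖ ≤ v₀ x)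
    (hv₀ne : ∃ x : EuclideanSpace ℝ (Fin n), v₀ x ≠ φ ‖x‖)
    (v : EuclideanSpace ℝ (Fin n) → ℝ → ℝ) (hv : IsBddClassicalSol n p v v₀) :
    Tendsto (fun t => ⨆ x : EuclideanSpace ℝ (Fin n), v x t) atTop atTop := by
  refine tendsto_atTop.2 fun b => ?_
  obtain ⟨t1, ht1, h⟩ := Inst.growth hφ hn hpS hpc hα hv₀cont hv hv₀ge hv₀ne b
  filter_upwards [eventually_ge_atTop t1] with T hT
  obtain ⟨M, hM⟩ := hv.bdd T (by linarith)
  refine (h T hT).trans (le_ciSup (f := fun x => v x T) ⟨M, ?_⟩ 0)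
  rintro _ ⟨x, rfl⟩
  exact hM x T ⟨by linarith, le_rfl⟩
end
end

section
/- Let n ≥ 3 be an integer, p > 1 with ν := 2/(p−1) < n−2, and let κ > 0 satisfy (κ+1)pL^{p−1} < (n−2)²/4, and set γ := (n−2)/2 − √((n−2)²/4 − (κ+1)pL^{p−1}). Let φ : [0,∞) → ℝ be continuous with 0 ≤ φ(r) ≤ L r^{−ν} for all r > 0, and let f : [0,∞) → ℝ be C¹ on [0,∞) and C² on (0,∞) with f'' + ((n−1)/r)f' + (κ+1)p φ^{p−1} f = 0 for r > 0, f(0) = 1 and f'(0) = 0. Then f(r) > 0 for all r ≥ 0, and there exists c > 0 such that f(r) ≥ c r^{−γ} for all r > 1. -/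
noncomputable section

open Real Filter Set

/-- `ν = 2/(p-1)`. -/
def nuExp (p : ℝ) : ℝ := 2 / (p - 1)

/-- `L = (ν(n−2−ν))^{1/(p−1)}`. -/
def Lconst (n : ℕ) (p : ℝ) : ℝ := (nuExp p * ((n : ℝ) - 2 - nuExp p)) ^ (1 / (p - 1))

/-- Lemma 2.1, lower estimate: let `n ≥ 3`, `p > 1` with `ν < n−2`, `κ > 0`
with `(κ+1)pL^{p−1} < (n−2)²/4`, and `γ = (n−2)/2 − √((n−2)²/4 − (κ+1)pL^{p−1})`.
If `0 ≤ φ(r) ≤ L r^{−ν}` for all `r > 0` and `f` is `C¹` on `[0,∞)`, `C²` on `(0,∞)`,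
solves `f'' + ((n−1)/r)f' + (κ+1)p φ^{p−1} f = 0` with `f(0) = 1`, `f'(0) = 0`, then
`f > 0` on `[0,∞)` and `f(r) ≥ c r^{−γ}` for `r > 1`, for some `c > 0`. -/
theorem linearized_ode_lower_bound (n : ℕ) (hn : 3 ≤ n) (p κ γ : ℝ) (hp : 1 < p)
    (hnu : nuExp p < (n : ℝ) - 2) (hκ : 0 < κ)
    (hκ0 : (κ + 1) * p * Lconst n p ^ (p - 1) < ((n : ℝ) - 2) ^ 2 / 4)
    (hγ : γ = ((n : ℝ) - 2) / 2 -
      Real.sqrt (((n : ℝ) - 2) ^ 2 / 4 - (κ + 1) * p * Lconst n p ^ (p - 1)))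
    (φ : ℝ → ℝ) (hφcont : ContinuousOn φ (Set.Ici 0))
    (hφnonneg : ∀ r > (0 : ℝ), 0 ≤ φ r)
    (hφupper : ∀ r > (0 : ℝ), φ r ≤ Lconst n p * r ^ (-nuExp p))
    (f : ℝ → ℝ) (hf1 : ContDiffOn ℝ 1 f (Set.Ici 0)) (hf2 : ContDiffOn ℝ 2 f (Set.Ioi 0))
    (hode : ∀ r > (0 : ℝ),
      deriv (deriv f) r + ((n : ℝ) - 1) / r * deriv f r + (κ + 1) * p * φ r ^ (p - 1) * f r = 0)
    (hf0 : f 0 = 1) (hf0' : derivWithin f (Set.Ici 0) 0 = 0) :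
    (∀ r ≥ (0 : ℝ), 0 < f r) ∧ ∃ c > 0, ∀ r > (1 : ℝ), c * r ^ (-γ) ≤ f r := by
  have hn' : (3:ℝ) ≤ n := by exact_mod_cast hn
  set K := (κ + 1) * p * Lconst n p ^ (p - 1) with hK
  have hp1 : 0 < p - 1 := by linarith
  have hν : 0 < nuExp p := by unfold nuExp; positivity
  have hL : 0 ≤ Lconst n p := by
    unfold Lconst
    exact Real.rpow_nonneg (mul_nonneg hν.le (by linarith)) _
  have hsq : Real.sqrt (((n : ℝ) - 2) ^ 2 / 4 - K) ^ 2 = ((n : ℝ) - 2) ^ 2 / 4 - K :=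
    Real.sq_sqrt (by linarith)
  have hs0 := Real.sqrt_nonneg (((n : ℝ) - 2) ^ 2 / 4 - K)
  have ha : 0 < (n:ℝ) - 2 - γ := by rw [hγ]; linarith
  have hroot : γ * ((n:ℝ) - 2 - γ) = K := by rw [hγ]; linarith
  have hV : ∀ r > (0:ℝ), r ^ 2 * ((κ + 1) * p * φ r ^ (p - 1)) ≤ K := by
    intro r hr
    have h1 : φ r ^ (p - 1) ≤ (Lconst n p * r ^ (-nuExp p)) ^ (p - 1) :=
      Real.rpow_le_rpow (hφnonneg r hr) (hφupper r hr) hp1.le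
    have h2 : (Lconst n p * r ^ (-nuExp p)) ^ (p - 1) = Lconst n p ^ (p - 1) * (r ^ 2)⁻¹ := by
      rw [Real.mul_rpow hL (Real.rpow_nonneg hr.le _), ← Real.rpow_mul hr.le]
      have : -nuExp p * (p - 1) = -(2:ℝ) := by unfold nuExp; field_simp
      rw [this, Real.rpow_neg hr.le]
      norm_num
    rw [h2] at h1
    have h3 : r ^ 2 * φ r ^ (p - 1) ≤ Lconst n p ^ (p - 1) := by
      calc r ^ 2 * φ r ^ (p - 1) ≤ r ^ 2 * (Lconst n p ^ (p - 1) * (r ^ 2)⁻¹) := by gcongr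
        _ = Lconst n p ^ (p - 1) := by field_simp
    calc r ^ 2 * ((κ + 1) * p * φ r ^ (p - 1)) = (κ + 1) * p * (r ^ 2 * φ r ^ (p - 1)) := by ring
      _ ≤ K := by rw [hK]; gcongr
  -- derivatives
  have hfc : ContinuousOn f (Set.Ici 0) := hf1.continuousOn
  have hDc : ContinuousOn (derivWithin f (Set.Ici 0)) (Set.Ici 0) :=
    hf1.continuousOn_derivWithin (uniqueDiffOn_Ici 0) le_rfl
  have hDeq : ∀ r > (0:ℝ), derivWithin f (Set.Ici 0) r = deriv f r := fun r hr =>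
    derivWithin_of_mem_nhds (Ici_mem_nhds hr)
  have hfd : ∀ r > (0:ℝ), HasDerivAt f (deriv f r) r := fun r hr =>
    ((hf2.differentiableOn (by norm_num)).differentiableAt (Ioi_mem_nhds hr)).hasDerivAt
  have hfdd : ∀ r > (0:ℝ), HasDerivAt (deriv f) (deriv (deriv f) r) r := by
    intro r hr
    have h1 : ContDiffOn ℝ 1 (deriv f) (Set.Ioi 0) :=
      ((contDiffOn_succ_iff_deriv_of_isOpen (n := 1) isOpen_Ioi).1 (by rw [one_add_one_eq_two]; exact hf2)).2.2
    exact ((h1.differentiableOn (by norm_num)).differentiableAt (Ioi_mem_nhds hr)).hasDerivAt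
  set a := (n:ℝ) - 2 - γ with hadef
  set W : ℝ → ℝ := fun r => r ^ a * (r * derivWithin f (Set.Ici 0) r + γ * f r) with hW
  have hWc : ContinuousOn W (Set.Ici 0) := by
    apply ContinuousOn.mul
    · exact (Real.continuous_rpow_const ha.le).continuousOn
    · exact (continuousOn_id.mul hDc).add (continuousOn_const.mul hfc)
  have hW0 : W 0 = 0 := by simp [hW, Real.zero_rpow ha.ne']
  have hWd : ∀ r > (0:ℝ), HasDerivAt W
      (r ^ (a - 1) * (f r * (K - r ^ 2 * ((κ + 1) * p * φ r ^ (p - 1))))) r := by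
    intro r hr
    have h1 : HasDerivAt (fun r => r ^ a * (r * deriv f r + γ * f r))
        (a * r ^ (a - 1) * (r * deriv f r + γ * f r)
          + r ^ a * ((1 * deriv f r + r * deriv (deriv f) r) + γ * deriv f r)) r :=
      (Real.hasDerivAt_rpow_const (Or.inl hr.ne')).mul
        (((hasDerivAt_id r).mul (hfdd r hr)).add ((hfd r hr).const_mul γ))
    have h2 : W =ᶠ[nhds r] (fun r => r ^ a * (r * deriv f r + γ * f r)) := by
      filter_upwards [Ioi_mem_nhds hr] with x hx
      simp only [hW, hDeq x hx]
    refine (h1.congr_of_eventuallyEq h2).congr_deriv ?_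
    have h3 : r ^ a = r ^ (a - 1) * r := by
      rw [← Real.rpow_add_one hr.ne']; congr 1; ring
    have h4 : r * deriv (deriv f) r
        = -((n:ℝ) - 1) * deriv f r - r * ((κ + 1) * p * φ r ^ (p - 1) * f r) := by
      have := hode r hr
      field_simp at this
      linear_combination this
    rw [h3, h4, ← hroot]
    rw [hadef]
    ring
  have key : ∀ R > (0:ℝ), (∀ r, 0 ≤ r → r < R → 0 < f r) →
      MonotoneOn (fun r => r ^ γ * f r) (Set.Ioc 0 R) := by
    intro R hR hpos
    have hWm : MonotoneOn W (Set.Icc 0 R) := by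
      apply monotoneOn_of_deriv_nonneg (convex_Icc 0 R) (hWc.mono Set.Icc_subset_Ici_self)
      · rw [interior_Icc]
        exact fun r hr => (hWd r hr.1).differentiableAt.differentiableWithinAt
      · rw [interior_Icc]
        intro r hr
        rw [(hWd r hr.1).deriv]
        exact mul_nonneg (Real.rpow_nonneg hr.1.le _)
          (mul_nonneg (hpos r hr.1.le hr.2).le (by linarith [hV r hr.1]))
    have hd : ∀ r > (0:ℝ), HasDerivAt (fun r => r ^ γ * f r)
        (γ * r ^ (γ - 1) * f r + r ^ γ * deriv f r) r := fun r hr =>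
      (Real.hasDerivAt_rpow_const (Or.inl hr.ne')).mul (hfd r hr)
    apply monotoneOn_of_deriv_nonneg (convex_Ioc 0 R)
    · exact fun r hr => (hd r hr.1).continuousAt.continuousWithinAt
    · rw [interior_Ioc]
      exact fun r hr => (hd r hr.1).differentiableAt.differentiableWithinAt
    · rw [interior_Ioc]
      intro r hr
      rw [(hd r hr.1).deriv]
      have h0 : 0 ≤ W r := by
        rw [← hW0]
        exact hWm ⟨le_rfl, hR.le⟩ ⟨hr.1.le, hr.2.le⟩ hr.1.le
      simp only [hW, hDeq r hr.1] at h0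
      have h1 := nonneg_of_mul_nonneg_right h0 (Real.rpow_pos_of_pos hr.1 a)
      have h3 : r ^ γ = r ^ (γ - 1) * r := by
        rw [← Real.rpow_add_one hr.1.ne']; congr 1; ring
      rw [h3]
      have h5 := mul_nonneg (Real.rpow_nonneg hr.1.le (γ - 1)) h1
      linarith
  have hpos : ∀ r ≥ (0:ℝ), 0 < f r := by
    by_contra! hcon
    obtain ⟨r0, hr0, hfr0⟩ := hcon
    set S := Set.Ici (0:ℝ) ∩ f ⁻¹' Set.Iic 0 with hS
    have hSc : IsClosed S := hfc.preimage_isClosed_of_isClosed isClosed_Ici isClosed_Iic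
    have hSb : BddBelow S := ⟨0, fun x hx => hx.1⟩
    have hmem : sInf S ∈ S := hSc.csInf_mem ⟨r0, hr0, hfr0⟩ hSb
    set R := sInf S
    have hR0 : 0 ≤ R := hmem.1
    have hfR : f R ≤ 0 := hmem.2
    have hR : 0 < R := by
      rcases hR0.lt_or_eq with h | h
      · exact h
      · rw [← h, hf0] at hfR; linarith
    have hlt : ∀ r, 0 ≤ r → r < R → 0 < f r := by
      intro r h0 h1
      by_contra! h2
      exact absurd (csInf_le hSb (show r ∈ S from ⟨h0, h2⟩)) (not_le.2 h1)
    have hm := key R hR hlt (a := R / 2) ⟨by linarith, by linarith⟩ (b := R) ⟨hR, le_rfl⟩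
      (by linarith)
    have h1 : 0 < (R / 2) ^ γ * f (R / 2) :=
      mul_pos (Real.rpow_pos_of_pos (by linarith) _) (hlt _ (by linarith) (by linarith))
    have h2 : R ^ γ * f R ≤ 0 :=
      mul_nonpos_of_nonneg_of_nonpos (Real.rpow_nonneg hR.le _) hfR
    simp only at hm
    linarith
  refine ⟨hpos, f 1, hpos 1 (by norm_num), fun r hr => ?_⟩
  have hr0 : 0 < r := by linarith
  have hm := key r hr0 (fun x hx _ => hpos x hx) (a := 1) ⟨by norm_num, hr.le⟩ (b := r)
    ⟨hr0, le_rfl⟩ hr.le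
  simp only [Real.one_rpow, one_mul] at hm
  rw [Real.rpow_neg hr0.le, ← div_eq_mul_inv, div_le_iff₀ (Real.rpow_pos_of_pos hr0 γ)]
  linarith
end
end

section
/- Let n ≥ 3 be an integer, p > 1 with ν := 2/(p−1) < n−2, and let κ > 0 satisfy (κ+1)pL^{p−1} < (n−2)²/4, and set γ := (n−2)/2 − √((n−2)²/4 − (κ+1)pL^{p−1}). Let φ : [0,∞) → ℝ be continuous with 0 ≤ φ(r) ≤ L r^{−ν} for all r > 0, and suppose in addition that there exist a > 0 and λ > 0 with φ(r) ≥ L r^{−ν} − a r^{−ν−λ} for all r > 0. Let f : [0,∞) → ℝ be C¹ on [0,∞) and C² on (0,∞) with f'' + ((n−1)/r)f' + (κ+1)p φ^{p−1} f = 0 for r > 0, f(0) = 1 and f'(0) = 0. Then f is positive on [0,∞) and there exists C > 0 such that f(r) ≤ C r^{−γ} for all r > 1. -/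
noncomputable section

open Real Filter Set

lemma hd_rpow_mul {f : ℝ → ℝ} {f' r : ℝ} (e : ℝ) (hr : 0 < r) (hf : HasDerivAt f f' r) :
    HasDerivAt (fun x => x ^ e * f x) (r ^ e * (e / r * f r + f')) r := by
  have h1 := (Real.hasDerivAt_rpow_const (p := e) (Or.inl hr.ne')).mul hf
  refine h1.congr_deriv ?_
  rw [Real.rpow_sub_one hr.ne']
  field_simp

lemma anti_of_deriv {F F' : ℝ → ℝ} (h : ∀ r ≥ (1:ℝ), HasDerivAt F (F' r) r)
    (h' : ∀ r ≥ (1:ℝ), F' r ≤ 0) : ∀ r ≥ (1:ℝ), F r ≤ F 1 := by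
  intro r hr
  have : AntitoneOn F (Ici 1) := by
    apply antitoneOn_of_deriv_nonpos (convex_Ici 1)
    · intro x hx
      exact (h x hx).continuousAt.continuousWithinAt
    · intro x hx
      rw [interior_Ici] at hx
      exact (h x (le_of_lt hx)).differentiableAt.differentiableWithinAt
    · intro x hx
      rw [interior_Ici] at hx
      rw [(h x (le_of_lt hx)).deriv]
      exact h' x (le_of_lt hx)
  exact this (by simp) hr hr

lemma mono_of_deriv {F F' : ℝ → ℝ} {s : ℝ} (hc : ContinuousOn F (Ici 0))
    (h : ∀ r > (0:ℝ), HasDerivAt F (F' r) r)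
    (h' : ∀ r, 0 < r → r < s → 0 ≤ F' r) : MonotoneOn F (Icc 0 s) := by
  apply monotoneOn_of_deriv_nonneg (convex_Icc 0 s)
  · exact hc.mono Icc_subset_Ici_self
  · intro x hx
    rw [interior_Icc] at hx
    exact (h x hx.1).differentiableAt.differentiableWithinAt
  · intro x hx
    rw [interior_Icc] at hx
    rw [(h x hx.1).deriv]
    exact h' x hx.1 hx.2

lemma ode_core (N γ B lam : ℝ) (hγ : 0 < γ) (hm : 0 < N - 2 - 2 * γ)
    (hlam : 0 < lam) (hlm : lam < N - 2 - 2 * γ) (hB : 0 < B)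
    (q f g h : ℝ → ℝ)
    (hfc : ContinuousOn f (Ici 0)) (hgc : ContinuousOn g (Ici 0))
    (hf : ∀ r > (0:ℝ), HasDerivAt f (g r) r) (hg : ∀ r > (0:ℝ), HasDerivAt g (h r) r)
    (hode : ∀ r > (0:ℝ), h r + (N - 1) / r * g r + q r * f r = 0)
    (hq : ∀ r > (0:ℝ), q r ≤ γ * (N - 2 - γ) / r ^ 2)
    (hq' : ∀ r ≥ (1:ℝ), γ * (N - 2 - γ) / r ^ 2 - B * r ^ (-lam) / r ^ 2 ≤ q r)
    (hf0 : f 0 = 1) :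
    (∀ r ≥ (0 : ℝ), 0 < f r) ∧ ∃ C > 0, ∀ r > (1 : ℝ), f r ≤ C * r ^ (-γ) := by
  set m := N - 2 - 2 * γ with hmdef
  have hN : N = m + 2 + 2 * γ := by rw [hmdef]; ring
  set w : ℝ → ℝ := fun r => r ^ γ * f r with hw
  set V : ℝ → ℝ := fun r => r ^ (m + 1 + γ) * g r + γ * (r ^ (m + γ) * f r) with hV
  have hwd : ∀ r > (0:ℝ), HasDerivAt w (r ^ (-(m + 1)) * V r) r := by
    intro r hr
    refine (hd_rpow_mul γ hr (hf r hr)).congr_deriv ?_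
    simp only [hV]
    have e1 : r ^ (m + 1 + γ) = r ^ (m + 1) * r ^ γ := Real.rpow_add hr _ _
    have e2 : r ^ (m + γ) = r ^ (m + 1) * r ^ γ / r := by
      rw [← Real.rpow_add hr, ← Real.rpow_sub_one hr.ne']; congr 1; ring
    have e3 := (Real.rpow_pos_of_pos hr (m + 1)).ne'
    rw [e1, e2, Real.rpow_neg hr.le]
    field_simp
    ring
  have hVd : ∀ r > (0:ℝ), HasDerivAt V
      (r ^ (m + 1 + γ) * ((γ * (N - 2 - γ) / r ^ 2 - q r) * f r)) r := by
    intro r hr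
    refine ((hd_rpow_mul (m + 1 + γ) hr (hg r hr)).add
      ((hd_rpow_mul (m + γ) hr (hf r hr)).const_mul γ)).congr_deriv ?_
    have e1 : h r = - ((N - 1) / r * g r) - q r * f r := by linarith [hode r hr]
    have e2 : r ^ (m + γ) = r ^ (m + 1 + γ) / r := by
      rw [← Real.rpow_sub_one hr.ne']; congr 1; ring
    rw [e1, e2, hN]
    field_simp
    ring
  have hwc : ContinuousOn w (Ici 0) :=
    (Real.continuous_rpow_const hγ.le).continuousOn.mul hfc
  have hVc : ContinuousOn V (Ici 0) := by
    apply ContinuousOn.add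
    · exact (Real.continuous_rpow_const (by linarith)).continuousOn.mul hgc
    · exact continuousOn_const.mul
        ((Real.continuous_rpow_const (by linarith)).continuousOn.mul hfc)
  have hV0 : V 0 = 0 := by
    simp only [hV]
    rw [Real.zero_rpow (by linarith), Real.zero_rpow (by linarith)]; simp
  have claimV : ∀ s > (0:ℝ), (∀ x, 0 < x → x < s → 0 < f x) → ∀ x ∈ Icc 0 s, 0 ≤ V x := by
    intro s hs hpos x hx
    have := mono_of_deriv hVc hVd (s := s) (by
      intro r hr hrs
      have := hq r hr
      have := hpos r hr hrs
      apply mul_nonneg (Real.rpow_nonneg hr.le _)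
      apply mul_nonneg (by linarith) this.le)
    rw [← hV0]
    exact this ⟨le_refl _, hs.le⟩ hx hx.1
  have claimw : ∀ s > (0:ℝ), (∀ x, 0 < x → x < s → 0 < f x) → MonotoneOn w (Icc 0 s) := by
    intro s hs hpos
    apply mono_of_deriv hwc hwd
    intro r hr hrs
    exact mul_nonneg (Real.rpow_nonneg hr.le _) (claimV s hs hpos r ⟨hr.le, hrs.le⟩)
  have hpos : ∀ r ≥ (0:ℝ), 0 < f r := by
    intro r hr
    by_contra hcon
    push Not at hcon
    have hfr : ContinuousOn f (Icc 0 r) := hfc.mono Icc_subset_Ici_self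
    have hcl : IsClosed (Icc 0 r ∩ f ⁻¹' (Iic 0)) :=
      hfr.preimage_isClosed_of_isClosed isClosed_Icc isClosed_Iic
    have hcp : IsCompact (Icc 0 r ∩ f ⁻¹' (Iic 0)) :=
      isCompact_Icc.of_isClosed_subset hcl inter_subset_left
    obtain ⟨s, ⟨⟨hs0, hsr⟩, hfs⟩, hsl⟩ := hcp.exists_isLeast ⟨r, ⟨hr, le_refl _⟩, hcon⟩
    simp only [mem_preimage, mem_Iic] at hfs
    have hs : 0 < s := by
      rcases hs0.lt_or_eq with h | h
      · exact h
      · rw [← h, hf0] at hfs; linarith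
    have hps : ∀ x, 0 < x → x < s → 0 < f x := by
      intro x hx hxs
      by_contra hc
      push Not at hc
      have := hsl ⟨⟨hx.le, by linarith⟩, hc⟩
      linarith
    have h1 := claimw s hs hps (a := s / 2) (b := s) ⟨by linarith, by linarith⟩
      ⟨by linarith, le_refl _⟩ (by linarith)
    have h2 : 0 < w (s / 2) := mul_pos (Real.rpow_pos_of_pos (by linarith) _)
      (hps _ (by linarith) (by linarith))
    have h3 : w s ≤ 0 := mul_nonpos_of_nonneg_of_nonpos (Real.rpow_nonneg hs.le _) hfs
    linarith
  refine ⟨hpos, ?_⟩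
  have hVnn : ∀ r > (0:ℝ), 0 ≤ V r := fun r hr =>
    claimV r hr (fun x hx _ => hpos x hx.le) r ⟨hr.le, le_refl _⟩
  have hwpos : ∀ r > (0:ℝ), 0 < w r := fun r hr =>
    mul_pos (Real.rpow_pos_of_pos hr _) (hpos r hr.le)
  have hw1 : ∀ r ≥ (1:ℝ), w 1 ≤ w r := by
    intro r hr
    exact claimw r (by linarith) (fun x hx _ => hpos x hx.le) ⟨by linarith, hr⟩
      ⟨by linarith, le_refl _⟩ hr
  have hml : 0 < m - lam := by linarith
  set K := B / (m - lam) with hK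
  have hKpos : 0 < K := div_pos hB hml
  have hE := anti_of_deriv (F := fun r => V r - K * (r ^ (m - lam) * w r))
    (fun r hr => (hVd r (by linarith)).sub
      ((hd_rpow_mul (m - lam) (by linarith) (hwd r (by linarith))).const_mul K)) (by
    intro r hr
    have hr0 : 0 < r := by linarith
    have e1 : K * (r ^ (m - lam) * ((m - lam) / r * w r + r ^ (-(m + 1)) * V r)) =
      B * r ^ (m - lam) / r * w r + K * (r ^ (m - lam) * (r ^ (-(m + 1)) * V r)) := by
      rw [hK]; field_simp
    have e2 : r ^ (m + 1 + γ) * ((γ * (N - 2 - γ) / r ^ 2 - q r) * f r) ≤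
        r ^ (m + 1 + γ) * ((B * r ^ (-lam) / r ^ 2) * f r) := by
      have := hq' r hr
      have := hpos r hr0.le
      have := Real.rpow_nonneg hr0.le (m + 1 + γ)
      gcongr
      linarith
    have e3 : r ^ (m + 1 + γ) * ((B * r ^ (-lam) / r ^ 2) * f r)
        = B * r ^ (m - lam) / r * w r := by
      simp only [hw]
      rw [show m + 1 + γ = m + γ + 1 by ring, Real.rpow_add_one hr0.ne', Real.rpow_add hr0,
        sub_eq_add_neg, Real.rpow_add hr0]
      field_simp
    have e4 : 0 ≤ K * (r ^ (m - lam) * (r ^ (-(m + 1)) * V r)) := by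
      have := hVnn r hr0
      positivity
    linarith)
  set c0 := |V 1 - K * (1 ^ (m - lam) * w 1)| with hc0
  have hw1pos := hwpos 1 one_pos
  set K' := K + c0 / w 1 with hK'
  have hVle : ∀ r ≥ (1:ℝ), V r ≤ K' * (r ^ (m - lam) * w r) := by
    intro r hr
    have h1 := hE r hr
    have h2 : V 1 - K * (1 ^ (m - lam) * w 1) ≤ c0 := le_abs_self _
    have h3 : 1 ≤ r ^ (m - lam) := Real.one_le_rpow hr hml.le
    have h4 : w 1 ≤ r ^ (m - lam) * w r := by
      nlinarith [hw1 r hr]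
    have h5 : c0 ≤ c0 / w 1 * (r ^ (m - lam) * w r) := by
      calc c0 = c0 / w 1 * w 1 := by field_simp
        _ ≤ _ := by
          apply mul_le_mul_of_nonneg_left h4 (by positivity)
    rw [hK', add_mul]
    linarith
  have hK'pos : 0 < K' := by positivity
  have hG := anti_of_deriv (F := fun r => Real.exp (K' / lam * r ^ (-lam)) * w r)
    (fun r hr => (((Real.hasDerivAt_rpow_const (p := -lam)
      (Or.inl (by linarith : r ≠ 0))).const_mul (K' / lam)).exp).mul (hwd r (by linarith))) (by
    intro r hr
    have hr0 : 0 < r := by linarith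
    have e1 : r ^ (-(m + 1)) * V r ≤ K' * r ^ (-lam - 1) * w r := by
      calc r ^ (-(m + 1)) * V r ≤ r ^ (-(m + 1)) * (K' * (r ^ (m - lam) * w r)) :=
            mul_le_mul_of_nonneg_left (hVle r hr) (Real.rpow_nonneg hr0.le _)
        _ = K' * (r ^ (-(m + 1)) * r ^ (m - lam)) * w r := by ring
        _ = _ := by rw [← Real.rpow_add hr0]; congr 3; ring
    have e2 : K' / lam * (-lam * r ^ (-lam - 1)) = - (K' * r ^ (-lam - 1)) := by
      field_simp
    rw [e2]
    have := Real.exp_pos (K' / lam * r ^ (-lam))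
    nlinarith)
  refine ⟨Real.exp (K' / lam * 1 ^ (-lam)) * w 1, by positivity, ?_⟩
  intro r hr
  have hr0 : 0 < r := by linarith
  have h1 := hG r hr.le
  have h2 : 1 ≤ Real.exp (K' / lam * r ^ (-lam)) := Real.one_le_exp (by positivity)
  have h3 : w r ≤ Real.exp (K' / lam * 1 ^ (-lam)) * w 1 := by
    nlinarith [hwpos r hr0]
  have h4 : f r = w r * r ^ (-γ) := by
    simp only [hw]
    rw [mul_right_comm, ← Real.rpow_add hr0]; simp
  rw [h4]
  exact mul_le_mul_of_nonneg_right h3 (Real.rpow_nonneg hr0.le _)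

lemma one_sub_rpow_ge {x b : ℝ} (hb : 0 < b) (hx0 : 0 ≤ x) (hx1 : x ≤ 1) :
    1 - (1 + b) * x ≤ (1 - x) ^ b := by
  rcases le_total 1 b with h | h
  · have := one_add_mul_self_le_rpow_one_add (s := -x) (by linarith) h
    rw [← sub_eq_add_neg] at this
    nlinarith
  · have := Real.rpow_le_rpow_of_exponent_ge' (x := 1 - x) (by linarith) (by linarith) hb.le h
    rw [Real.rpow_one] at this
    nlinarith

/-- Lemma 2.1, upper estimate: let `n ≥ 3`, `p > 1` with `ν < n−2`, `κ > 0`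
with `(κ+1)pL^{p−1} < (n−2)²/4`, and `γ = (n−2)/2 − √((n−2)²/4 − (κ+1)pL^{p−1})`.
If `0 ≤ φ(r) ≤ L r^{−ν}` for all `r > 0` and in addition `φ(r) ≥ L r^{−ν} − a r^{−ν−λ}`
for some `a, λ > 0`, and `f` is `C¹` on `[0,∞)`, `C²` on `(0,∞)`, solves
`f'' + ((n−1)/r)f' + (κ+1)p φ^{p−1} f = 0` with `f(0) = 1`, `f'(0) = 0`, then `f > 0` on
`[0,∞)` and `f(r) ≤ C r^{−γ}` for `r > 1`, for some `C > 0`. -/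
theorem linearized_ode_upper_bound (n : ℕ) (hn : 3 ≤ n) (p κ γ a lam : ℝ) (hp : 1 < p)
    (hnu : nuExp p < (n : ℝ) - 2) (hκ : 0 < κ)
    (hκ0 : (κ + 1) * p * Lconst n p ^ (p - 1) < ((n : ℝ) - 2) ^ 2 / 4)
    (hγ : γ = ((n : ℝ) - 2) / 2 -
      Real.sqrt (((n : ℝ) - 2) ^ 2 / 4 - (κ + 1) * p * Lconst n p ^ (p - 1)))
    (ha : 0 < a) (hlam : 0 < lam)
    (φ : ℝ → ℝ) (hφcont : ContinuousOn φ (Set.Ici 0))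
    (hφnonneg : ∀ r > (0 : ℝ), 0 ≤ φ r)
    (hφupper : ∀ r > (0 : ℝ), φ r ≤ Lconst n p * r ^ (-nuExp p))
    (hφlower : ∀ r > (0 : ℝ),
      Lconst n p * r ^ (-nuExp p) - a * r ^ (-nuExp p - lam) ≤ φ r)
    (f : ℝ → ℝ) (hf1 : ContDiffOn ℝ 1 f (Set.Ici 0)) (hf2 : ContDiffOn ℝ 2 f (Set.Ioi 0))
    (hode : ∀ r > (0 : ℝ),
      deriv (deriv f) r + ((n : ℝ) - 1) / r * deriv f r + (κ + 1) * p * φ r ^ (p - 1) * f r = 0)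
    (hf0 : f 0 = 1) (hf0' : derivWithin f (Set.Ici 0) 0 = 0) :
    (∀ r ≥ (0 : ℝ), 0 < f r) ∧ ∃ C > 0, ∀ r > (1 : ℝ), f r ≤ C * r ^ (-γ) := by
  have hb : 0 < p - 1 := by linarith
  have hnu0 : 0 < nuExp p := div_pos two_pos hb
  have hX : 0 < nuExp p * ((n : ℝ) - 2 - nuExp p) := mul_pos hnu0 (by linarith)
  have hL : 0 < Lconst n p := Real.rpow_pos_of_pos hX _
  have hn' : (3 : ℝ) ≤ n := by exact_mod_cast hn
  set L := Lconst n p with hLdef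
  have hM : 0 < L ^ (p - 1) := Real.rpow_pos_of_pos hL _
  set D := (κ + 1) * p with hD
  have hD0 : 0 < D := by positivity
  set A := D * L ^ (p - 1) with hA
  have hA0 : 0 < A := mul_pos hD0 hM
  set S := Real.sqrt (((n : ℝ) - 2) ^ 2 / 4 - A) with hS
  have hS0 : 0 < S := Real.sqrt_pos.mpr (by linarith)
  have hS2 : S ^ 2 = ((n : ℝ) - 2) ^ 2 / 4 - A := Real.sq_sqrt (by linarith)
  have hγ0 : 0 < γ := by
    have : S < ((n : ℝ) - 2) / 2 := by
      apply lt_of_pow_lt_pow_left₀ 2 (by linarith)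
      rw [hS2]; nlinarith
    linarith
  have hm : 0 < (n : ℝ) - 2 - 2 * γ := by linarith
  have hAγ : γ * ((n : ℝ) - 2 - γ) = A := by rw [hγ]; nlinarith
  have hrnu : ∀ r > (0:ℝ), (r ^ (-nuExp p)) ^ (p - 1) = 1 / r ^ 2 := by
    intro r hr
    rw [← Real.rpow_mul hr.le]
    have : -nuExp p * (p - 1) = -2 := by
      unfold nuExp; field_simp
    rw [this, Real.rpow_neg hr.le]
    norm_num
  set l := min lam (((n : ℝ) - 2 - 2 * γ) / 2) with hl
  have hl0 : 0 < l := lt_min hlam (by linarith)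
  have hlm : l < (n : ℝ) - 2 - 2 * γ := lt_of_le_of_lt (min_le_right _ _) (by linarith)
  have hgd : ∀ r > (0:ℝ), derivWithin f (Ici 0) r = deriv f r := fun r hr =>
    derivWithin_of_mem_nhds (Ici_mem_nhds hr)
  refine ode_core n γ (A * ((1 + (p - 1)) * (a / L))) l hγ0 hm hl0 hlm (by positivity)
    (fun r => D * φ r ^ (p - 1)) f (derivWithin f (Ici 0)) (deriv (deriv f))
    hf1.continuousOn (hf1.continuousOn_derivWithin (uniqueDiffOn_Ici 0) le_rfl) ?_ ?_ ?_ ?_ ?_ hf0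
  · intro r hr
    rw [hgd r hr]
    exact ((hf2.contDiffAt (Ioi_mem_nhds hr)).differentiableAt (by norm_num)).hasDerivAt
  · intro r hr
    have h1 : ContDiffOn ℝ 1 (deriv f) (Ioi 0) := 
      ((contDiffOn_succ_iff_deriv_of_isOpen (n := 1) isOpen_Ioi).1 (by
        rw [one_add_one_eq_two]; exact hf2)).2.2
    have h2 := ((h1.contDiffAt (Ioi_mem_nhds hr)).differentiableAt (by norm_num)).hasDerivAt
    refine h2.congr_of_eventuallyEq ?_
    filter_upwards [Ioi_mem_nhds hr] with x hx using hgd x hx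
  · intro r hr
    rw [hgd r hr]
    exact hode r hr
  · intro r hr
    rw [hAγ]
    have h1 := Real.rpow_le_rpow (hφnonneg r hr) (hφupper r hr) hb.le
    rw [Real.mul_rpow hL.le (Real.rpow_nonneg hr.le _), hrnu r hr] at h1
    calc D * φ r ^ (p - 1) ≤ D * (L ^ (p - 1) * (1 / r ^ 2)) := by gcongr
      _ = _ := by rw [hA]; ring
  · intro r hr
    have hr0 : 0 < r := by linarith
    rw [hAγ]
    set x := a / L * r ^ (-lam) with hx
    have hx0 : 0 ≤ x := by positivity
    have hxl : x ≤ a / L * r ^ (-l) := by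
      rw [hx]
      gcongr
      · exact min_le_left _ _
    have key : L ^ (p - 1) * (1 / r ^ 2) * (1 - (1 + (p - 1)) * x) ≤ φ r ^ (p - 1) := by
      rcases le_total x 1 with h | h
      · have h1 : L * r ^ (-nuExp p) * (1 - x) ≤ φ r := by
          refine le_trans (le_of_eq ?_) (hφlower r hr0)
          rw [hx, sub_eq_add_neg (-nuExp p), Real.rpow_add hr0]
          field_simp
        have h2 := Real.rpow_le_rpow (by
          apply mul_nonneg (by positivity) (by linarith)) h1 hb.le
        rw [Real.mul_rpow (by positivity) (by linarith), Real.mul_rpow hL.le (by positivity),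
          hrnu r hr0] at h2
        refine le_trans ?_ h2
        apply mul_le_mul_of_nonneg_left (one_sub_rpow_ge hb hx0 h) (by positivity)
      · have h1 : 0 ≤ φ r ^ (p - 1) := Real.rpow_nonneg (hφnonneg r hr0) _
        refine le_trans ?_ h1
        apply mul_nonpos_of_nonneg_of_nonpos (by positivity)
        nlinarith
    calc A / r ^ 2 - A * ((1 + (p - 1)) * (a / L)) * r ^ (-l) / r ^ 2
        = D * (L ^ (p - 1) * (1 / r ^ 2) * (1 - (1 + (p - 1)) * (a / L * r ^ (-l)))) := by
          rw [hA]; ring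
      _ ≤ D * (L ^ (p - 1) * (1 / r ^ 2) * (1 - (1 + (p - 1)) * x)) := by
          gcongr
      _ ≤ D * φ r ^ (p - 1) := by gcongr
end
end

section
/- Let p > 1, ν := 2/(p−1), L > 0, λ > 0, γ > ν + λ, and let a > a' > 0. Suppose φ, ψ : (0,∞) → ℝ satisfy φ(r) = L r^{−ν} − a r^{−ν−λ} + o(r^{−ν−λ}) and ψ(r) = L r^{−ν} − a' r^{−ν−λ} + o(r^{−ν−λ}) as r → ∞, and f : (0,∞) → [0,∞) satisfies f(r) ≤ C₀ r^{−γ} for all r > 1 with some C₀ > 0. Then for all A ≥ 0 and B ≥ 0 there exist r₀ > 0 and c > 0 such that (ψ(r) − B f(r))^{p−1} − (φ(r) + A f(r))^{p−1} ≥ c r^{−2−λ} for all r > r₀ (in particular ψ − Bf > 0 on (r₀,∞)). -/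
noncomputable section

open Real Filter Set Asymptotics

theorem power_gap (q L b d : ℝ) (hq : 0 < q) (hL : 0 < L) (hbd : b < d) :
    ∃ c > (0 : ℝ), ∀ᶠ t : ℝ in nhds 0, 0 < t →
      c * t ≤ (L - b * t) ^ q - (L - d * t) ^ q := by
  have hlin : ∀ b : ℝ, HasDerivAt (fun t : ℝ => (L - b * t) ^ q) (-b * q * L ^ (q - 1)) 0 := by
    intro b
    have h1 : HasDerivAt (fun t : ℝ => L - b * t) (-b) 0 := by
      simpa using ((hasDerivAt_id (0 : ℝ)).const_mul b).const_sub L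
    have := h1.rpow_const (p := q) (Or.inl (by simpa using hL.ne'))
    simpa using this
  have h := (hlin b).sub (hlin d)
  have hK : 0 < (d - b) * q * L ^ (q - 1) :=
    mul_pos (mul_pos (by linarith) hq) (rpow_pos_of_pos hL _)
  refine ⟨(d - b) * q * L ^ (q - 1) / 2, by positivity, ?_⟩
  have h2 := (hasDerivAt_iff_isLittleO_nhds_zero.1 h).def (half_pos hK)
  filter_upwards [h2] with t h3 ht
  simp only [Pi.sub_apply, zero_add, mul_zero, sub_zero, sub_self, smul_eq_mul,
    Real.norm_eq_abs, abs_of_pos ht, abs_le] at h3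
  linarith [h3.1]

/-- Lemma 2.2: let `p > 1`, `ν = 2/(p−1)`, `L > 0`, `λ > 0`, `γ > ν + λ`,
`a > a' > 0`. Suppose `φ(r) = L r^{−ν} − a r^{−ν−λ} + o(r^{−ν−λ})` and
`ψ(r) = L r^{−ν} − a' r^{−ν−λ} + o(r^{−ν−λ})` as `r → ∞`, and `0 ≤ f(r) ≤ C₀ r^{−γ}`
for `r > 1`. Then for all `A, B ≥ 0` there are `r₀ > 0` and `c > 0` with
`(ψ(r) − Bf(r))^{p−1} − (φ(r) + Af(r))^{p−1} ≥ c r^{−2−λ}` for all `r > r₀`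
(in particular `ψ − Bf > 0` on `(r₀,∞)`). -/
theorem separation_of_powers (p ν L lam γ a a' C₀ : ℝ) (hp : 1 < p)
    (hν : ν = 2 / (p - 1)) (hL : 0 < L) (hlam : 0 < lam) (hγ : ν + lam < γ)
    (ha' : 0 < a') (haa : a' < a) (hC₀ : 0 < C₀)
    (φ ψ f : ℝ → ℝ)
    (hφ : (fun r => φ r - (L * r ^ (-ν) - a * r ^ (-ν - lam)))
      =o[atTop] fun r => r ^ (-ν - lam))
    (hψ : (fun r => ψ r - (L * r ^ (-ν) - a' * r ^ (-ν - lam)))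
      =o[atTop] fun r => r ^ (-ν - lam))
    (hfnonneg : ∀ r > (0 : ℝ), 0 ≤ f r)
    (hfbound : ∀ r > (1 : ℝ), f r ≤ C₀ * r ^ (-γ)) :
    ∀ A ≥ (0 : ℝ), ∀ B ≥ (0 : ℝ), ∃ r₀ > (0 : ℝ), ∃ c > (0 : ℝ), ∀ r > r₀,
      0 < ψ r - B * f r ∧
      c * r ^ (-2 - lam) ≤ (ψ r - B * f r) ^ (p - 1) - (φ r + A * f r) ^ (p - 1) := by
  intro A hA B hB
  obtain ⟨q, hq⟩ : ∃ q, q = p - 1 := ⟨_, rfl⟩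
  have hq0 : 0 < q := by linarith
  rw [← hq] at hν ⊢
  have hνq : -ν * q = -2 := by rw [hν]; field_simp
  obtain ⟨ε, hε⟩ : ∃ ε, ε = (a - a') / 6 := ⟨_, rfl⟩
  have hε0 : 0 < ε := by linarith
  have key := power_gap q L (a' + 2 * ε) (a - 2 * ε) hq0 hL (by linarith)
  obtain ⟨c, hc, hkey⟩ := key
  have ht : Tendsto (fun r : ℝ => r ^ (-lam)) atTop (nhds 0) := tendsto_rpow_neg_atTop hlam
  have hu : Tendsto (fun r : ℝ => r ^ (-(γ - (ν + lam)))) atTop (nhds 0) :=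
    tendsto_rpow_neg_atTop (by linarith)
  have e1 := ht.eventually hkey
  have e2 : ∀ᶠ r : ℝ in atTop, (a + ε) * r ^ (-lam) < L := by
    have := ht.const_mul (a + ε)
    rw [mul_zero] at this
    exact this.eventually_lt_const hL
  have e3 : ∀ᶠ r : ℝ in atTop, (A * C₀) * r ^ (-(γ - (ν + lam))) < ε := by
    have := hu.const_mul (A * C₀)
    rw [mul_zero] at this
    exact this.eventually_lt_const hε0
  have e4 : ∀ᶠ r : ℝ in atTop, (B * C₀) * r ^ (-(γ - (ν + lam))) < ε := by
    have := hu.const_mul (B * C₀)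
    rw [mul_zero] at this
    exact this.eventually_lt_const hε0
  have e5 := hφ.def hε0
  have e6 := hψ.def hε0
  have main : ∀ᶠ r : ℝ in atTop, 0 < ψ r - B * f r ∧
      c * r ^ (-2 - lam) ≤ (ψ r - B * f r) ^ q - (φ r + A * f r) ^ q := by
    filter_upwards [e1, e2, e3, e4, e5, e6, eventually_gt_atTop 1] with r h1 h2 h3 h4 h5 h6 hr
    have hr0 : 0 < r := by linarith
    have hs : r ^ (-ν - lam) = r ^ (-ν) * r ^ (-lam) := by
      rw [← rpow_add hr0]; ring_nf
    have hg : r ^ (-γ) = r ^ (-(γ - (ν + lam))) * (r ^ (-ν) * r ^ (-lam)) := by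
      rw [← rpow_add hr0, ← rpow_add hr0]; ring_nf
    have h2l : r ^ (-2 - lam) = (r ^ (-ν)) ^ q * r ^ (-lam) := by
      rw [← rpow_mul hr0.le, hνq, ← rpow_add hr0]; ring_nf
    have hf0 := hfnonneg r hr0
    have hf1 := hfbound r hr
    rw [hg] at hf1
    rw [hs] at h5 h6
    rw [h2l]
    have hR : 0 < r ^ (-ν) := rpow_pos_of_pos hr0 _
    have hT : 0 < r ^ (-lam) := rpow_pos_of_pos hr0 _
    generalize r ^ (-ν) = R at *
    generalize r ^ (-lam) = t at *
    generalize r ^ (-(γ - (ν + lam))) = u at *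
    have hRt : 0 < R * t := mul_pos hR hT
    rw [Real.norm_eq_abs, Real.norm_eq_abs, abs_of_pos hRt, abs_le] at h5 h6
    have hAf : A * f r ≤ ε * (R * t) := by
      calc A * f r ≤ A * (C₀ * (u * (R * t))) := by gcongr
        _ = (A * C₀ * u) * (R * t) := by ring
        _ ≤ _ := by gcongr
    have hBf : B * f r ≤ ε * (R * t) := by
      calc B * f r ≤ B * (C₀ * (u * (R * t))) := by gcongr
        _ = (B * C₀ * u) * (R * t) := by ring
        _ ≤ _ := by gcongr
    have hAf0 : 0 ≤ A * f r := mul_nonneg hA hf0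
    have hX : R * (L - (a' + 2 * ε) * t) ≤ ψ r - B * f r := by linarith [h6.1]
    have hY : φ r + A * f r ≤ R * (L - (a - 2 * ε) * t) := by linarith [h5.2]
    have hY0 : 0 < φ r + A * f r := by
      have : 0 < R * (L - (a + ε) * t) := mul_pos hR (by linarith)
      linarith [h5.1]
    have hd : 0 < L - (a - 2 * ε) * t := by nlinarith
    have hb : 0 < L - (a' + 2 * ε) * t := by nlinarith
    have hX0 := mul_pos hR hb
    refine ⟨by linarith, ?_⟩
    have i1 := rpow_le_rpow hX0.le hX hq0.le
    have i2 := rpow_le_rpow hY0.le hY hq0.le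
    rw [mul_rpow hR.le hb.le] at i1
    rw [mul_rpow hR.le hd.le] at i2
    have hRq : 0 < R ^ q := rpow_pos_of_pos hR q
    have := mul_le_mul_of_nonneg_left (h1 hT) hRq.le
    linarith
  obtain ⟨N, hN⟩ := eventually_atTop.1 main
  exact ⟨max N 1, by positivity, c, hc, fun r hr => hN r ((le_max_left _ _).trans hr.le)⟩
end
end
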